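/- Let H be a fixed graph. Then with probability tending to 1 as n → ∞, the hitting time of connectivity in the random motif graph process equals the hitting time of minimum degree one: τ_c = τ_1, where τ_c = min{i : Ḡ_i(H,n) is connected} and τ_1 = min{i : δ(Ḡ_i(H,n)) ≥ 1}. -/

import Mathlib

open Filter

namespace RandomMotif

/-- `G` is a *copy* of `H` in the complete graph on `Fin n`: the image of `H`
under an injection of its vertices into `Fin n`. -/
def IsCopy {k n : ℕ} (H : SimpleGraph (Fin k)) (G : SimpleGraph (Fin n)) : Prop :=
  ∃ f : Fin k ↪ Fin n, G = H.map f

/-- The type of copies of `H` in `K_n`. -/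
abbrev Copy {k : ℕ} (H : SimpleGraph (Fin k)) (n : ℕ) : Type :=
  {G : SimpleGraph (Fin n) // IsCopy H G}

/-- `N`, the total number of copies of `H` in `K_n`. -/
noncomputable def numCopies {k : ℕ} (H : SimpleGraph (Fin k)) (n : ℕ) : ℕ :=
  Nat.card (Copy H n)

/-- A sample of the random motif graph process: a uniformly random ordering
`H_1, H_2, …, H_N` of all copies of `H` in `K_n`. -/
abbrev ProcSample {k : ℕ} (H : SimpleGraph (Fin k)) (n : ℕ) : Type :=
  Fin (numCopies H n) ≃ Copy H n

/-- The probability (uniform over all orderings of the copies) of the event `P`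
for the random motif graph process. -/
noncomputable def procProb {k : ℕ} (H : SimpleGraph (Fin k)) (n : ℕ)
    (P : ProcSample H n → Prop) : ℝ :=
  (Nat.card {ω : ProcSample H n // P ω} : ℝ) / (Nat.card (ProcSample H n) : ℝ)

/-- `Ḡ_i(H,n)`: the union of the first `i` copies of the process. -/
noncomputable def procGraph {k n : ℕ} {H : SimpleGraph (Fin k)} (ω : ProcSample H n)
    (i : ℕ) : SimpleGraph (Fin n) :=
  ⨆ j : Fin (numCopies H n), if (j : ℕ) < i then (ω j).1 else ⊥

/-- `τ_d`: the hitting time of minimum degree at least `d`. -/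
noncomputable def tauDeg {k n : ℕ} {H : SimpleGraph (Fin k)} (d : ℕ)
    (ω : ProcSample H n) : ℕ :=
  sInf {i : ℕ | ∀ v : Fin n, d ≤ ((procGraph ω i).neighborSet v).ncard}

/-- `τ_c`: the hitting time of connectivity. -/
noncomputable def tauConn {k n : ℕ} {H : SimpleGraph (Fin k)} (ω : ProcSample H n) : ℕ :=
  sInf {i : ℕ | (procGraph ω i).Connected}

section Proofs

section Orderings

open Finset
open scoped Classical

theorem card_filter_apply_notMem_add {ι α : Type*} [Fintype ι] [DecidableEq ι]
    [DecidableEq α] (B : Finset α) (e : ι ≃ α) (I : Finset ι) (hI : ∀ i ∈ I, e i ∉ B) :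
    #{j ∈ Iᶜ | e j ∉ B} + #I + #B = Fintype.card ι := by
  have h1 : #{j | e j ∈ B} = #B := by
    refine card_bij (fun j _ => e j) ?_ ?_ ?_
    · intro j hj; simpa using hj
    · intro i _ j _ h; exact e.injective h
    · intro b hb; exact ⟨e.symm b, by simpa using hb, by simp⟩
  have h2 : #{j ∈ Iᶜ | e j ∉ B} + #{j ∈ Iᶜ | ¬ e j ∉ B} = #Iᶜ :=
    card_filter_add_card_filter_not _
  have h3 : Iᶜ.filter (fun j => ¬ e j ∉ B) = univ.filter fun j => e j ∈ B := by
    ext j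
    simp only [mem_filter, mem_compl, not_not, mem_univ, true_and]
    exact ⟨fun h => h.2, fun h => ⟨fun hj => hI j hj h, h⟩⟩
  rw [h3, h1] at h2
  have := card_add_card_compl I
  omega

variable {ι α : Type*} [Fintype ι] [Fintype α] [DecidableEq ι] [DecidableEq α]

/-- Averaging over a set `J` of exchangeable positions. -/
theorem card_mul_card_filter_and_apply (Q : ι ≃ α → Prop) [DecidablePred Q]
    (J : Finset ι) (R : α → Prop) [DecidablePred R] {j₀ : ι}
    (hQ : ∀ e : ι ≃ α, ∀ j ∈ J, Q e → Q ((Equiv.swap j₀ j).trans e)) :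
    #J * #{e : ι ≃ α | Q e ∧ R (e j₀)} = ∑ e : ι ≃ α with Q e, #{j ∈ J | R (e j)} := by
  have hswap : ∀ j ∈ J, #{e : ι ≃ α | Q e ∧ R (e j)} = #{e : ι ≃ α | Q e ∧ R (e j₀)} := by
    intro j hj
    refine card_nbij' (fun e => (Equiv.swap j₀ j).trans e) (fun e => (Equiv.swap j₀ j).trans e)
      ?_ ?_ ?_ ?_
    · intro e he
      simp only [coe_filter, mem_univ, true_and, Set.mem_ofPred_eq] at he ⊢
      exact ⟨hQ e j hj he.1, by simpa using he.2⟩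
    · intro e he
      simp only [coe_filter, mem_univ, true_and, Set.mem_ofPred_eq] at he ⊢
      exact ⟨hQ e j hj he.1, by simpa using he.2⟩
    · intro e _
      ext i
      simp
    · intro e _
      ext i
      simp
  calc #J * #{e : ι ≃ α | Q e ∧ R (e j₀)}
      = ∑ j ∈ J, #{e : ι ≃ α | Q e ∧ R (e j)} := by
        rw [sum_congr rfl hswap, sum_const, smul_eq_mul]
    _ = ∑ e : ι ≃ α with Q e, #{j ∈ J | R (e j)} := by
        simp only [← filter_filter, card_filter _ J]
        simp only [card_filter]
        rw [sum_comm]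

/-- One step of exposing the ordering while avoiding `B`. -/
theorem card_avoid_insert (B : Finset α) (I : Finset ι) {i₀ : ι} (hi₀ : i₀ ∉ I) :
    (#{e : ι ≃ α | ∀ i ∈ insert i₀ I, e i ∉ B} : ℝ) * (Fintype.card ι - #I) =
      #{e : ι ≃ α | ∀ i ∈ I, e i ∉ B} * (Fintype.card ι - #B - #I) := by
  have key := card_mul_card_filter_and_apply (fun e : ι ≃ α => ∀ i ∈ I, e i ∉ B) Iᶜ
    (fun a => a ∉ B) (j₀ := i₀) (by
      intro e j hj he i hi
      have h1 : i ≠ i₀ := fun h => hi₀ (h ▸ hi)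
      have h2 : i ≠ j := fun h => (mem_compl.1 hj) (h ▸ hi)
      simpa [Equiv.swap_apply_of_ne_of_ne h1 h2] using he i hi)
  have hset : (univ.filter fun e : ι ≃ α => ∀ i ∈ insert i₀ I, e i ∉ B) =
      univ.filter fun e : ι ≃ α => (∀ i ∈ I, e i ∉ B) ∧ e i₀ ∉ B := by
    ext e
    simp [and_comm]
  rw [hset]
  have hsum : ((∑ e : ι ≃ α with (∀ i ∈ I, e i ∉ B), #{j ∈ Iᶜ | e j ∉ B} : ℕ) : ℝ) =
      #{e : ι ≃ α | ∀ i ∈ I, e i ∉ B} * (Fintype.card ι - #B - #I) := by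
    push_cast
    rw [← nsmul_eq_mul, ← sum_const]
    refine sum_congr rfl fun e he => ?_
    have h := card_filter_apply_notMem_add B e I (by simpa using he)
    rw [← h]
    push_cast
    ring
  rw [← hsum, ← key]
  have hc : (#I : ℝ) + #Iᶜ = Fintype.card ι := by exact_mod_cast card_add_card_compl I
  push_cast
  rw [← hc]
  ring

theorem card_mul_card_filter_apply_eq (j : ι) (c : α) :
    Fintype.card ι * #{e : ι ≃ α | e j = c} = Fintype.card (ι ≃ α) := by
  have key := card_mul_card_filter_and_apply (fun _ : ι ≃ α => True) univ
    (fun a => a = c) (j₀ := j) (by simp)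
  have h1 : ∀ e : ι ≃ α, #{j | e j = c} = 1 := by
    intro e
    rw [card_eq_one]
    exact ⟨e.symm c, by ext i; simp [Equiv.eq_symm_apply]⟩
  simpa [h1] using key

/-- The ordering puts `c` at position `j`, and positions in `I` avoid `B`. -/
theorem card_apply_eq_avoid_le (B : Finset α) (hB : B.Nonempty) (c : α) (j : ι) (I : Finset ι)
    (hj : j ∉ I) :
    (#{e : ι ≃ α | e j = c ∧ ∀ i ∈ I, e i ∉ B} : ℝ) ≤
      #{e : ι ≃ α | e j = c} * Real.exp (-((#B - 1) / Fintype.card ι)) ^ #I := by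
  induction I using Finset.induction_on with
  | empty => simp
  | insert i₀ I hi₀ ih =>
    have hjI : j ∉ I := fun h => hj (mem_insert_of_mem h)
    have hji : i₀ ≠ j := fun h => hj (h ▸ mem_insert_self _ _)
    have key := card_mul_card_filter_and_apply
      (fun e : ι ≃ α => e j = c ∧ ∀ i ∈ I, e i ∉ B) (insert j I)ᶜ
      (fun a => a ∉ B) (j₀ := i₀) (by
        rintro e j' hj' ⟨hec, he⟩
        simp only [mem_compl, mem_insert, not_or] at hj'
        refine ⟨?_, fun i hi => ?_⟩
        · simpa [Equiv.swap_apply_of_ne_of_ne hji.symm (Ne.symm hj'.1)] using hec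
        · have h1 : i ≠ i₀ := fun h => hi₀ (h ▸ hi)
          have h2 : i ≠ j' := fun h => hj'.2 (h ▸ hi)
          simpa [Equiv.swap_apply_of_ne_of_ne h1 h2] using he i hi)
    have hset : (univ.filter fun e : ι ≃ α => e j = c ∧ ∀ i ∈ insert i₀ I, e i ∉ B) =
        univ.filter fun e : ι ≃ α => (e j = c ∧ ∀ i ∈ I, e i ∉ B) ∧ e i₀ ∉ B := by
      ext e
      simp only [mem_insert, forall_eq_or_imp, mem_filter, mem_univ, true_and]
      tauto
    rw [hset, card_insert_of_notMem hi₀, pow_succ, ← mul_assoc]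
    set q : ℝ := Real.exp (-((#B - 1) / Fintype.card ι)) with hq
    have hsum : ((∑ e : ι ≃ α with (e j = c ∧ ∀ i ∈ I, e i ∉ B),
        #{j' ∈ (insert j I)ᶜ | e j' ∉ B} : ℕ) : ℝ) ≤
        #{e : ι ≃ α | e j = c ∧ ∀ i ∈ I, e i ∉ B} * (Fintype.card ι - #B - #I) := by
      push_cast
      rw [← nsmul_eq_mul, ← sum_const]
      refine sum_le_sum fun e he => ?_
      have h := card_filter_apply_notMem_add B e I (by simpa using (mem_filter.1 he).2.2)
      rw [← h]
      have hle : #{j' ∈ (insert j I)ᶜ | e j' ∉ B} ≤ #{j' ∈ Iᶜ | e j' ∉ B} :=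
        card_le_card (filter_subset_filter _ (compl_subset_compl.2 (subset_insert _ _)))
      have : (#{j' ∈ (insert j I)ᶜ | e j' ∉ B} : ℝ) ≤ #{j' ∈ Iᶜ | e j' ∉ B} := by
        exact_mod_cast hle
      push_cast
      linarith
    have hc : (#I : ℝ) + 1 + #(insert j I)ᶜ = Fintype.card ι := by
      have := card_add_card_compl (insert j I)
      rw [card_insert_of_notMem hjI] at this
      exact_mod_cast this
    have hJpos : (0 : ℝ) < #(insert j I)ᶜ := by
      have : 0 < #(insert j I)ᶜ := card_pos.2 ⟨i₀, by simp [hji, hi₀]⟩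
      exact_mod_cast this
    rw [← key] at hsum
    push_cast at hsum
    set X : ℝ := ((#{e : ι ≃ α | (e j = c ∧ ∀ i ∈ I, e i ∉ B) ∧ e i₀ ∉ B} : ℕ) : ℝ)
    set Y : ℝ := ((#{e : ι ≃ α | e j = c ∧ ∀ i ∈ I, e i ∉ B} : ℕ) : ℝ)
    have hY : 0 ≤ Y := Nat.cast_nonneg _
    have hb : (1 : ℝ) ≤ #B := by exact_mod_cast hB.card_pos
    have hI0 : (0 : ℝ) ≤ #I := Nat.cast_nonneg _
    have hstep : (Fintype.card ι - #B - #I : ℝ) ≤ #(insert j I)ᶜ * q := by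
      have hq1 : 1 - ((#B : ℝ) - 1) / Fintype.card ι ≤ q := by
        have := Real.add_one_le_exp (-(((#B : ℝ) - 1) / Fintype.card ι))
        linarith
      have hN : (0 : ℝ) < Fintype.card ι := by linarith
      have : ((#B : ℝ) - 1) / Fintype.card ι * #(insert j I)ᶜ ≤ #B - 1 := by
        rw [div_mul_eq_mul_div, div_le_iff₀ hN]
        exact mul_le_mul_of_nonneg_left (by linarith) (by linarith)
      nlinarith
    have hXY : X ≤ Y * q := by
      have : (#(insert j I)ᶜ : ℝ) * X ≤ #(insert j I)ᶜ * (Y * q) := by nlinarith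
      exact le_of_mul_le_mul_left this hJpos
    refine hXY.trans ?_
    exact mul_le_mul_of_nonneg_right (ih hjI) (Real.exp_pos _).le

end Orderings

open Finset
open scoped Classical

/-- The uniform probability of `P` on a finite type. -/
noncomputable def unifProb {Ω : Type*} [Fintype Ω] (P : Ω → Prop) : ℝ :=
  (#{ω | P ω} : ℝ) / Fintype.card Ω

section UnifProb

variable {Ω : Type*} [Fintype Ω]

theorem unifProb_eq (P : Ω → Prop) [DecidablePred P] :
    unifProb P = (#{ω | P ω} : ℝ) / Fintype.card Ω := by
  unfold unifProb
  congr!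

theorem unifProb_nonneg (P : Ω → Prop) : 0 ≤ unifProb P := by
  unfold unifProb; positivity

theorem unifProb_mono {P Q : Ω → Prop} (h : ∀ ω, P ω → Q ω) : unifProb P ≤ unifProb Q := by
  unfold unifProb
  gcongr with ω
  exact h ω

theorem unifProb_exists_le {β : Type*} (s : Finset β) (P : β → Ω → Prop) :
    unifProb (fun ω => ∃ b ∈ s, P b ω) ≤ ∑ b ∈ s, unifProb (P b) := by
  unfold unifProb
  rw [← sum_div]
  gcongr
  rw [← Nat.cast_sum, Nat.cast_le]
  refine (card_le_card ?_).trans card_biUnion_le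
  intro ω hω
  simpa using hω

theorem unifProb_or_le (P Q : Ω → Prop) :
    unifProb (fun ω => P ω ∨ Q ω) ≤ unifProb P + unifProb Q := by
  rw [unifProb_eq, unifProb_eq P, unifProb_eq Q, ← add_div, filter_or]
  gcongr
  exact_mod_cast card_union_le _ _

theorem unifProb_add_unifProb_not [Nonempty Ω] (P : Ω → Prop) :
    unifProb P + unifProb (fun ω => ¬ P ω) = 1 := by
  have hc : (Fintype.card Ω : ℝ) ≠ 0 := by exact_mod_cast Fintype.card_ne_zero
  have h : #{ω | P ω} + #{ω | ¬ P ω} = Fintype.card Ω :=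
    card_filter_add_card_filter_not _
  rw [unifProb_eq P, unifProb_eq, ← add_div, div_eq_one_iff_eq hc]
  exact_mod_cast h

/-- The second moment method for pairwise non-positively correlated events. -/
theorem unifProb_forall_not_mul_le [Nonempty Ω] {V : Type*} [Fintype V] (E : V → Ω → Prop) (p : ℝ)
    (h₁ : ∀ v, unifProb (E v) = p)
    (h₂ : ∀ u v, u ≠ v → unifProb (fun ω => E u ω ∧ E v ω) ≤ p ^ 2) :
    unifProb (fun ω => ∀ v, ¬ E v ω) * (1 + Fintype.card V * p) ≤ 1 := by
  set n : ℝ := (Fintype.card V : ℝ) with hn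
  have hT : (0 : ℝ) < Fintype.card Ω := by exact_mod_cast Fintype.card_pos
  set T : ℝ := (Fintype.card Ω : ℝ) with hTdef
  have hone : unifProb (fun ω => ∀ v, ¬ E v ω) ≤ 1 := by
    have := unifProb_add_unifProb_not (fun ω => ∀ v, ¬ E v ω)
    have := unifProb_nonneg (fun ω => ¬ ∀ v, ¬ E v ω)
    linarith
  have hμ0 : 0 ≤ n * p := by
    rcases isEmpty_or_nonempty V with hV | ⟨⟨v⟩⟩
    · simp [hn]
    · have := unifProb_nonneg (E v)
      rw [h₁] at this
      positivity
  rcases hμ0.eq_or_lt with hμ | hμ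
  · rw [← hμ]; linarith
  set X : Ω → ℝ := fun ω => #{v | E v ω} with hX
  have hX1 : ∑ ω, X ω = n * p * T := by
    have : ∀ v, (#{ω | E v ω} : ℝ) = p * T := by
      intro v
      rw [← h₁ v, unifProb_eq, div_mul_cancel₀ _ hT.ne']
    calc ∑ ω, X ω = ∑ v, (#{ω | E v ω} : ℝ) := by
          simp only [hX, card_filter, Nat.cast_sum]
          rw [sum_comm]
      _ = n * p * T := by
          rw [sum_congr rfl fun v _ => this v, sum_const, nsmul_eq_mul, card_univ]
          ring
  have hX2 : ∑ ω, X ω ^ 2 ≤ (n * p + (n * p) ^ 2) * T := by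
    have hsq : ∀ ω, X ω ^ 2 = ∑ u, ∑ v, if E u ω ∧ E v ω then (1 : ℝ) else 0 := by
      intro ω
      have : X ω = ∑ v, if E v ω then (1 : ℝ) else 0 := by simp [hX]
      rw [this, sq, sum_mul_sum]
      refine sum_congr rfl fun u _ => sum_congr rfl fun v _ => ?_
      by_cases hu : E u ω <;> by_cases hv : E v ω <;> simp [hu, hv]
    have huv : ∀ u v, ∑ ω, (if E u ω ∧ E v ω then (1 : ℝ) else 0) ≤
        (p ^ 2 + if u = v then p else 0) * T := by
      intro u v
      have : ∑ ω, (if E u ω ∧ E v ω then (1 : ℝ) else 0) =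
          unifProb (fun ω => E u ω ∧ E v ω) * T := by
        rw [unifProb_eq, div_mul_cancel₀ _ hT.ne']
        simp
      rw [this]
      refine mul_le_mul_of_nonneg_right ?_ hT.le
      by_cases h : u = v
      · subst h
        have := h₁ u
        simp only [and_self, if_true, this]
        nlinarith
      · simpa [h] using h₂ u v h
    calc ∑ ω, X ω ^ 2
        = ∑ u, ∑ v, ∑ ω, if E u ω ∧ E v ω then (1 : ℝ) else 0 := by
          rw [sum_congr rfl fun ω _ => hsq ω, sum_comm]
          exact sum_congr rfl fun u _ => sum_comm
      _ ≤ ∑ u : V, ∑ v : V, (p ^ 2 + if u = v then p else 0) * T :=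
          sum_le_sum fun u _ => sum_le_sum fun v _ => huv u v
      _ = (n * p + (n * p) ^ 2) * T := by
          simp only [← sum_mul, sum_add_distrib, sum_const, sum_ite_eq, mem_univ, if_true,
            nsmul_eq_mul, card_univ]
          ring
  have hCS : (∑ ω, X ω) ^ 2 ≤ #{ω | ¬ ∀ v, ¬ E v ω} * ∑ ω, X ω ^ 2 := by
    have hsupp : ∑ ω, X ω = ∑ ω with ¬ ∀ v, ¬ E v ω, X ω := by
      refine (sum_filter_of_ne ?_).symm
      intro ω _ hne hall
      exact hne (by simp [hX, hall])
    rw [hsupp]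
    refine sq_sum_le_card_mul_sum_sq.trans ?_
    refine mul_le_mul_of_nonneg_left ?_ (Nat.cast_nonneg _)
    exact sum_le_sum_of_subset_of_nonneg (filter_subset _ _) fun ω _ _ => sq_nonneg (X ω)
  have hadd := unifProb_add_unifProb_not (fun ω => ∀ v, ¬ E v ω)
  set P := unifProb (fun ω => ∀ v, ¬ E v ω)
  have hQ : (#{ω | ¬ ∀ v, ¬ E v ω} : ℝ) = (1 - P) * T := by
    have : unifProb (fun ω => ¬ ∀ v, ¬ E v ω) = 1 - P := by linarith
    rw [← this, unifProb_eq, div_mul_cancel₀ _ hT.ne']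
  rw [hQ, hX1] at hCS
  have h3 : (n * p * T) ^ 2 ≤ (1 - P) * T * ((n * p + (n * p) ^ 2) * T) :=
    hCS.trans (mul_le_mul_of_nonneg_left hX2 (mul_nonneg (by linarith) hT.le))
  have h4 : (n * p * T ^ 2) * (n * p) ≤ (n * p * T ^ 2) * ((1 - P) * (1 + n * p)) := by
    nlinarith
  have h5 := le_of_mul_le_mul_left h4 (by positivity)
  linarith

end UnifProb

section Avoid

theorem unifProb_avoid_insert {ι α : Type*} [Fintype ι] [Fintype α] [DecidableEq ι]
    [DecidableEq α] (B : Finset α) (I : Finset ι) {i₀ : ι} (hi₀ : i₀ ∉ I) :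
    unifProb (fun e : ι ≃ α => ∀ i ∈ insert i₀ I, e i ∉ B) * (Fintype.card ι - #I) =
      unifProb (fun e : ι ≃ α => ∀ i ∈ I, e i ∉ B) * (Fintype.card ι - #B - #I) := by
  rw [unifProb_eq, unifProb_eq, div_mul_eq_mul_div, div_mul_eq_mul_div,
    card_avoid_insert B I hi₀]

theorem unifProb_apply_eq_avoid_le {ι α : Type*} [Fintype ι] [Fintype α] [DecidableEq ι]
    [DecidableEq α] (B : Finset α) (hB : B.Nonempty) (c : α) (j : ι) (I : Finset ι)
    (hj : j ∉ I) (hcard : Fintype.card ι = Fintype.card α) :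
    unifProb (fun e : ι ≃ α => e j = c ∧ ∀ i ∈ I, e i ∉ B) ≤
      1 / Fintype.card ι * Real.exp (-((#B - 1) / Fintype.card ι)) ^ #I := by
  have : Nonempty (ι ≃ α) := ⟨Fintype.equivOfCardEq hcard⟩
  have hT : (0 : ℝ) < Fintype.card (ι ≃ α) := by exact_mod_cast Fintype.card_pos
  have hN : (Fintype.card ι : ℝ) ≠ 0 := by
    have : Nonempty ι := ⟨j⟩
    exact_mod_cast Fintype.card_ne_zero
  have h2 : (Fintype.card ι : ℝ) * #{e : ι ≃ α | e j = c} = Fintype.card (ι ≃ α) := by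
    exact_mod_cast card_mul_card_filter_apply_eq j c
  rw [unifProb_eq, div_le_iff₀ hT, ← h2]
  refine (card_apply_eq_avoid_le B hB c j I hj).trans (le_of_eq ?_)
  field_simp

variable {N : ℕ} {α : Type*} [Fintype α] [DecidableEq α]

/-- The probability that the first `m` elements of a random ordering avoid `B`. -/
noncomputable def avoidProb (N : ℕ) (B : Finset α) (m : ℕ) : ℝ :=
  unifProb fun e : Fin N ≃ α => ∀ i : Fin N, (i : ℕ) < m → e i ∉ B

theorem avoidProb_nonneg (B : Finset α) (m : ℕ) : 0 ≤ avoidProb N B m := unifProb_nonneg _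

theorem avoidProb_zero (hN : Fintype.card α = N) (B : Finset α) : avoidProb N B 0 = 1 := by
  have : Nonempty (Fin N ≃ α) := ⟨(Fintype.equivFinOfCardEq hN).symm⟩
  have hc : (Fintype.card (Fin N ≃ α) : ℝ) ≠ 0 := by exact_mod_cast Fintype.card_ne_zero
  simp [avoidProb, unifProb, hc]

theorem avoidProb_succ (B : Finset α) {m : ℕ} (hm : m < N) :
    avoidProb N B (m + 1) * (N - m) = avoidProb N B m * (N - #B - m) := by
  set I : Finset (Fin N) := {i | (i : ℕ) < m} with hI
  have hcard : #I = m := by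
    rw [hI, Fin.card_filter_val_lt]; omega
  have key := unifProb_avoid_insert (ι := Fin N) B I (i₀ := ⟨m, hm⟩) (by simp [hI])
  rw [hcard, Fintype.card_fin] at key
  have h1 : ∀ e : Fin N ≃ α, (∀ i ∈ I, e i ∉ B) ↔ ∀ i : Fin N, (i : ℕ) < m → e i ∉ B := by
    simp [hI]
  have h2 : ∀ e : Fin N ≃ α, (∀ i ∈ insert ⟨m, hm⟩ I, e i ∉ B) ↔
      ∀ i : Fin N, (i : ℕ) < m + 1 → e i ∉ B := by
    intro e
    refine forall_congr' fun i => ?_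
    rw [mem_insert, Fin.ext_iff]
    simp only [hI, mem_filter, mem_univ, true_and]
    rw [Nat.lt_succ_iff_lt_or_eq, or_comm]
  simp only [avoidProb, ← h1, ← h2]
  exact key

theorem avoidProb_le_exp (hN : Fintype.card α = N) (B : Finset α) {m : ℕ} (hm : m ≤ N) :
    avoidProb N B m ≤ Real.exp (-(#B * m / N)) := by
  induction m with
  | zero => simp [avoidProb_zero hN]
  | succ m ih =>
    have hmN : (m : ℝ) < N := by exact_mod_cast hm
    have hm0 : (0 : ℝ) ≤ m := Nat.cast_nonneg _
    have hb0 : (0 : ℝ) ≤ #B := Nat.cast_nonneg _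
    have hNpos : (0 : ℝ) < N := by linarith
    have key := avoidProb_succ B hm
    have ih' := ih (by omega)
    have ha := avoidProb_nonneg (N := N) B m
    set q : ℝ := #B / N with hq
    have hq1 : 1 - q ≤ Real.exp (-q) := by
      have := Real.add_one_le_exp (-q); linarith
    have hqN : #B = q * (N : ℝ) := by rw [hq, div_mul_cancel₀ _ hNpos.ne']
    have hq0 : 0 ≤ q := div_nonneg hb0 hNpos.le
    have h1 : avoidProb N B (m + 1) ≤ avoidProb N B m * Real.exp (-q) := by
      have h2 : ((N : ℝ) - #B - m) ≤ Real.exp (-q) * (N - m) := by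
        rw [hqN]
        nlinarith [mul_nonneg hq0 hm0]
      have h3 : avoidProb N B (m + 1) * (N - m) ≤
          avoidProb N B m * Real.exp (-q) * (N - m) := by
        rw [key, mul_assoc]
        exact mul_le_mul_of_nonneg_left h2 ha
      exact le_of_mul_le_mul_right h3 (by linarith)
    calc avoidProb N B (m + 1) ≤ avoidProb N B m * Real.exp (-q) := h1
      _ ≤ Real.exp (-(#B * m / N)) * Real.exp (-q) :=
        mul_le_mul_of_nonneg_right ih' (Real.exp_pos _).le
      _ = Real.exp (-(#B * (m + 1 : ℕ) / N)) := by
        rw [← Real.exp_add, hq]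
        congr 1
        push_cast
        ring

theorem avoidProb_le_sq (hN : Fintype.card α = N) (B C : Finset α)
    (h : (N : ℝ) * (2 * #B - #C) ≤ (#B : ℝ) ^ 2) {m : ℕ} (hm : m ≤ N) :
    avoidProb N C m ≤ avoidProb N B m ^ 2 := by
  induction m with
  | zero => simp [avoidProb_zero hN]
  | succ m ih =>
    have hmN : (m : ℝ) < N := by exact_mod_cast hm
    have hm0 : (0 : ℝ) ≤ m := Nat.cast_nonneg _
    have keyB := avoidProb_succ B hm
    have keyC := avoidProb_succ C hm
    have ih' := ih (by omega)
    have ha := avoidProb_nonneg (N := N) C m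
    have hd : (0 : ℝ) < N - m := by linarith
    have hle : ((N : ℝ) - #C - m) * (N - m) ≤ (N - #B - m) ^ 2 := by
      by_cases hs : (2 * #B - #C : ℝ) ≤ 0
      · nlinarith [sq_nonneg (#B : ℝ)]
      · nlinarith
    have : avoidProb N C (m + 1) * (N - m) ^ 2 ≤ avoidProb N B (m + 1) ^ 2 * (N - m) ^ 2 := by
      calc avoidProb N C (m + 1) * (N - m) ^ 2
          = avoidProb N C m * (((N : ℝ) - #C - m) * (N - m)) := by
            rw [sq, ← mul_assoc, keyC, mul_assoc]
        _ ≤ avoidProb N C m * (N - #B - m) ^ 2 := mul_le_mul_of_nonneg_left hle ha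
        _ ≤ avoidProb N B m ^ 2 * (N - #B - m) ^ 2 :=
            mul_le_mul_of_nonneg_right ih' (sq_nonneg _)
        _ = avoidProb N B (m + 1) ^ 2 * (N - m) ^ 2 := by
            rw [← mul_pow, ← mul_pow, keyB]
    exact le_of_mul_le_mul_right this (by positivity)

theorem exp_neg_add_two_mul_sq_le {q : ℝ} (h0 : 0 ≤ q) (h1 : q ≤ 1 / 2) :
    Real.exp (-(q + 2 * q ^ 2)) ≤ 1 - q := by
  have h := Real.add_one_le_exp (q + 2 * q ^ 2)
  rw [Real.exp_neg, inv_le_comm₀ (Real.exp_pos _) (by linarith)]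
  refine le_trans ?_ h
  rw [inv_le_comm₀ (by linarith) (by positivity), inv_le_iff_one_le_mul₀ (by positivity)]
  nlinarith [mul_nonneg (sq_nonneg q) (by linarith : (0 : ℝ) ≤ 1 - 2 * q)]

theorem exp_le_avoidProb (hN : Fintype.card α = N) (B : Finset α) {q : ℝ} (hq0 : 0 ≤ q)
    (hq : q ≤ 1 / 2) {M : ℕ} (hM : (#B : ℝ) ≤ q * (N - M)) {m : ℕ} (hmM : m ≤ M) (hMN : M ≤ N) :
    Real.exp (-(m * (q + 2 * q ^ 2))) ≤ avoidProb N B m := by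
  induction m with
  | zero => simp [avoidProb_zero hN]
  | succ m ih =>
    have hmN : (m : ℝ) + 1 ≤ N := by exact_mod_cast hmM.trans hMN
    have hmM' : (m : ℝ) + 1 ≤ M := by exact_mod_cast hmM
    have key := avoidProb_succ (N := N) B (m := m) (by omega)
    have ih' := ih (by omega)
    have hd : (0 : ℝ) < N - m := by linarith
    have ha := avoidProb_nonneg (N := N) B m
    have h1 : avoidProb N B m * (1 - q) ≤ avoidProb N B (m + 1) := by
      have : avoidProb N B m * (1 - q) * (N - m) ≤ avoidProb N B (m + 1) * (N - m) := by
        rw [key, mul_assoc]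
        refine mul_le_mul_of_nonneg_left ?_ ha
        nlinarith
      exact le_of_mul_le_mul_right this hd
    calc Real.exp (-((m + 1 : ℕ) * (q + 2 * q ^ 2)))
        = Real.exp (-(m * (q + 2 * q ^ 2))) * Real.exp (-(q + 2 * q ^ 2)) := by
          rw [← Real.exp_add]; congr 1; push_cast; ring
      _ ≤ avoidProb N B m * (1 - q) :=
          mul_le_mul ih' (exp_neg_add_two_mul_sq_le hq0 hq) (Real.exp_pos _).le ha
      _ ≤ _ := h1

/-- The element `c` is at position `j`, and the first `m` elements avoid `B`. -/
theorem unifProb_apply_eq_and_avoid_le (hN : Fintype.card α = N) (B : Finset α) (hB : B.Nonempty)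
    (c : α) {m : ℕ} (hm : m ≤ N) (j : Fin N) :
    unifProb (fun e : Fin N ≃ α => e j = c ∧ ∀ i : Fin N, (i : ℕ) < m → e i ∉ B) ≤
      1 / N * Real.exp (2 - #B * m / N) := by
  have hNr : (0 : ℝ) < N := by exact_mod_cast j.pos
  have hm' : #(univ.filter fun i : Fin N => (i : ℕ) < m) = m := by
    rw [Fin.card_filter_val_lt]; omega
  obtain ⟨I, hI, hjI, hcard⟩ : ∃ I : Finset (Fin N), (∀ i ∈ I, (i : ℕ) < m) ∧ j ∉ I ∧
      m ≤ #I + 1 := by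
    refine ⟨(univ.filter fun i : Fin N => (i : ℕ) < m).erase j, ?_, by simp, ?_⟩
    · intro i hi
      simpa using (mem_erase.1 hi).2
    · have := pred_card_le_card_erase (s := univ.filter fun i : Fin N => (i : ℕ) < m) (a := j)
      omega
  have h1 := unifProb_apply_eq_avoid_le (ι := Fin N) B hB c j I hjI
    (by rw [Fintype.card_fin, hN])
  rw [Fintype.card_fin] at h1
  have h3 : Real.exp (-((#B - 1) / (N : ℝ))) ^ #I ≤ Real.exp (2 - #B * m / N) := by
    rw [← Real.exp_nat_mul]
    refine Real.exp_le_exp.2 ?_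
    have hb1 : (1 : ℝ) ≤ #B := by exact_mod_cast hB.card_pos
    have hbN : (#B : ℝ) ≤ N := by rw [← hN]; exact_mod_cast card_le_univ B
    have hmN : (m : ℝ) ≤ N := by exact_mod_cast hm
    have hcr : (m : ℝ) ≤ #I + 1 := by exact_mod_cast hcard
    have : (#B * m / N - 2 : ℝ) ≤ #I * ((#B - 1) / N) := by
      rw [← mul_div_assoc, sub_le_iff_le_add, div_le_iff₀ hNr, add_mul,
        div_mul_cancel₀ _ hNr.ne']
      nlinarith
    linarith
  refine (unifProb_mono fun e he => ⟨he.1, fun i hi => he.2 i (hI i hi)⟩).trans (h1.trans ?_)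
  gcongr

/-- The element `c` is among the first `M`, and the first `m` elements avoid `B`. -/
theorem unifProb_early_and_avoid_le (hN : Fintype.card α = N) (B : Finset α) (hB : B.Nonempty)
    (c : α) {m : ℕ} (hm : m ≤ N) (M : ℕ) :
    unifProb (fun e : Fin N ≃ α => ∃ j : Fin N, (j : ℕ) < M ∧ e j = c ∧
      ∀ i : Fin N, (i : ℕ) < m → e i ∉ B) ≤
    M / N * Real.exp (2 - #B * m / N) := by
  calc unifProb (fun e : Fin N ≃ α => ∃ j : Fin N, (j : ℕ) < M ∧ e j = c ∧
      ∀ i : Fin N, (i : ℕ) < m → e i ∉ B)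
      ≤ unifProb (fun e : Fin N ≃ α => ∃ j ∈ univ.filter fun j : Fin N => (j : ℕ) < M, e j = c ∧
        ∀ i : Fin N, (i : ℕ) < m → e i ∉ B) := unifProb_mono (by simp)
    _ ≤ ∑ j ∈ univ.filter fun j : Fin N => (j : ℕ) < M, unifProb (fun e : Fin N ≃ α => e j = c ∧
        ∀ i : Fin N, (i : ℕ) < m → e i ∉ B) := unifProb_exists_le _ _
    _ ≤ ∑ j ∈ univ.filter fun j : Fin N => (j : ℕ) < M, 1 / N * Real.exp (2 - #B * m / N) :=
        sum_le_sum fun j _ => unifProb_apply_eq_and_avoid_le hN B hB c hm j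
    _ ≤ M / N * Real.exp (2 - #B * m / N) := by
        rw [sum_const, nsmul_eq_mul, ← mul_assoc, mul_one_div, Fin.card_filter_val_lt]
        gcongr
        exact min_le_right _ _

end Avoid

section Copies

variable {k n : ℕ} {H : SimpleGraph (Fin k)}

noncomputable instance : Fintype (Copy H n) := Fintype.ofFinite _

theorem Copy.card_support (hiso : ∀ v, (H.neighborSet v).Nonempty) (c : Copy H n) :
    #{v | v ∈ c.1.support} = k := by
  obtain ⟨f, hf⟩ := c.2
  have : (univ.filter fun v => v ∈ c.1.support) = univ.map f := by
    ext v
    rw [hf]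
    simp only [mem_filter, mem_univ, true_and, Finset.mem_map, SimpleGraph.mem_support,
      SimpleGraph.map_adj]
    constructor
    · rintro ⟨w, a, b, _, rfl, rfl⟩
      exact ⟨a, rfl⟩
    · rintro ⟨a, rfl⟩
      obtain ⟨b, hb⟩ := hiso a
      exact ⟨f b, a, b, hb, rfl, rfl⟩
  rw [this, card_map, card_univ, Fintype.card_fin]

/-- The action of a permutation of the vertices on the copies of `H`. -/
def Copy.perm (σ : Equiv.Perm (Fin n)) (c : Copy H n) : Copy H n :=
  ⟨c.1.map σ.toEmbedding, by
    obtain ⟨G, f, rfl⟩ := c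
    exact ⟨f.trans σ.toEmbedding, SimpleGraph.map_map _ _ _⟩⟩

theorem Copy.perm_adj (σ : Equiv.Perm (Fin n)) (c : Copy H n) (u v : Fin n) :
    (c.perm σ).1.Adj (σ u) (σ v) ↔ c.1.Adj u v :=
  SimpleGraph.map_adj_apply (f := σ.toEmbedding)

theorem Copy.perm_mem_support (σ : Equiv.Perm (Fin n)) (c : Copy H n) (u : Fin n) :
    σ u ∈ (c.perm σ).1.support ↔ u ∈ c.1.support := by
  simp only [SimpleGraph.mem_support]
  rw [← σ.exists_congr_right (q := fun w => (c.perm σ).1.Adj (σ u) w)]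
  simp only [Copy.perm_adj]

theorem Copy.perm_perm_symm (σ : Equiv.Perm (Fin n)) (c : Copy H n) :
    (c.perm σ).perm σ.symm = c := by
  apply Subtype.ext
  ext u v
  have h1 := Copy.perm_adj σ.symm (c.perm σ) (σ u) (σ v)
  have h2 := Copy.perm_adj σ c u v
  simp only [Equiv.symm_apply_apply] at h1
  rw [h1, h2]

/-- The permutation action as a bijection on copies. -/
def Copy.permEquiv (σ : Equiv.Perm (Fin n)) : Copy H n ≃ Copy H n where
  toFun := Copy.perm σ
  invFun := Copy.perm σ.symm
  left_inv := Copy.perm_perm_symm σ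
  right_inv := Copy.perm_perm_symm σ.symm

theorem exists_perm_pair {V : Type*} [DecidableEq V] {u v u' v' : V} (h : u ≠ v) (h' : u' ≠ v') :
    ∃ σ : Equiv.Perm V, σ u = u' ∧ σ v = v' := by
  refine ⟨(Equiv.swap u u').trans (Equiv.swap (Equiv.swap u u' v) v'), ?_, by simp⟩
  have h1 : u' ≠ Equiv.swap u u' v := by
    intro he
    apply h
    have := congrArg (Equiv.swap u u') he
    simpa using this
  simp [Equiv.swap_apply_of_ne_of_ne h1 h']

/-- Double counting for an equivariant relation between copies and ordered pairs of vertices. -/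
theorem card_offDiag_mul_card_filter (P : Copy H n → Fin n → Fin n → Prop)
    [∀ c u v, Decidable (P c u v)]
    (hP : ∀ σ c u v, P (Copy.perm σ c) (σ u) (σ v) ↔ P c u v) {u v : Fin n} (huv : u ≠ v) :
    n * (n - 1) * #{c | P c u v} =
      ∑ c, #{p ∈ (univ : Finset (Fin n)).offDiag | P c p.1 p.2} := by
  have hsame : ∀ p ∈ (univ : Finset (Fin n)).offDiag,
      #{c | P c p.1 p.2} = #{c | P c u v} := by
    rintro ⟨a, b⟩ hab
    obtain ⟨σ, ha, hb⟩ := exists_perm_pair huv (by simpa using hab)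
    refine (card_equiv (Copy.permEquiv σ) fun c => ?_).symm
    simp only [mem_filter, mem_univ, true_and, ← ha, ← hb]
    exact (hP σ c u v).symm
  have : n * (n - 1) = #(univ : Finset (Fin n)).offDiag := by
    rw [offDiag_card, card_univ, Fintype.card_fin, Nat.mul_sub_one]
  rw [this, ← smul_eq_mul, ← sum_const, ← sum_congr rfl hsame]
  simp only [card_filter]
  rw [sum_comm]

theorem mul_card_filter_mem_support (hiso : ∀ v, (H.neighborSet v).Nonempty) (u : Fin n) :
    n * #{c : Copy H n | u ∈ c.1.support} = k * Fintype.card (Copy H n) := by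
  have hsame : ∀ v ∈ (univ : Finset (Fin n)),
      #{c : Copy H n | v ∈ c.1.support} = #{c : Copy H n | u ∈ c.1.support} := by
    intro v _
    refine (card_equiv (Copy.permEquiv (Equiv.swap u v)) fun c => ?_).symm
    simp only [mem_filter, mem_univ, true_and]
    have := Copy.perm_mem_support (Equiv.swap u v) c u
    rw [Equiv.swap_apply_left] at this
    exact this.symm
  calc n * #{c : Copy H n | u ∈ c.1.support}
      = ∑ v : Fin n, #{c : Copy H n | v ∈ c.1.support} := by
        rw [sum_congr rfl hsame, sum_const, card_univ, Fintype.card_fin, smul_eq_mul]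
    _ = ∑ c : Copy H n, #{v | v ∈ c.1.support} := by
        simp only [card_filter]
        rw [sum_comm]
    _ = k * Fintype.card (Copy H n) := by
        simp only [Copy.card_support hiso, sum_const, card_univ, smul_eq_mul]
        ring

theorem mul_card_filter_pair_mem_support (hiso : ∀ v, (H.neighborSet v).Nonempty) {u v : Fin n}
    (huv : u ≠ v) :
    n * (n - 1) * #{c : Copy H n | u ∈ c.1.support ∧ v ∈ c.1.support} =
      k * (k - 1) * Fintype.card (Copy H n) := by
  rw [card_offDiag_mul_card_filter (fun c u v => u ∈ c.1.support ∧ v ∈ c.1.support)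
    (fun σ c u v => by rw [Copy.perm_mem_support, Copy.perm_mem_support]) huv]
  have : ∀ c : Copy H n, #{p ∈ (univ : Finset (Fin n)).offDiag |
      p.1 ∈ c.1.support ∧ p.2 ∈ c.1.support} = k * (k - 1) := by
    intro c
    have h : ((univ : Finset (Fin n)).offDiag.filter fun p =>
        p.1 ∈ c.1.support ∧ p.2 ∈ c.1.support) =
        (univ.filter fun v => v ∈ c.1.support).offDiag := by
      ext p
      simp only [mem_filter, mem_offDiag, mem_univ, true_and]
      tauto
    rw [h, offDiag_card, Copy.card_support hiso, Nat.mul_sub_one]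
  simp only [this, sum_const, card_univ, smul_eq_mul]
  ring

theorem Copy.card_adj_le (hiso : ∀ v, (H.neighborSet v).Nonempty) (c : Copy H n) :
    #{p ∈ (univ : Finset (Fin n)).offDiag | c.1.Adj p.1 p.2} ≤ k ^ 2 := by
  have hsq : #((univ.filter fun v => v ∈ c.1.support) ×ˢ
      univ.filter fun v => v ∈ c.1.support) = k ^ 2 := by
    rw [card_product, Copy.card_support hiso c, sq]
  rw [← hsq]
  refine card_le_card fun p hp => ?_
  simp only [mem_filter, mem_univ, true_and, mem_product, SimpleGraph.mem_support] at hp ⊢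
  exact ⟨⟨_, hp.2⟩, ⟨_, hp.2.symm⟩⟩

theorem Copy.one_le_card_adj (hk : 0 < k) (hiso : ∀ v, (H.neighborSet v).Nonempty)
    (c : Copy H n) :
    1 ≤ #{p ∈ (univ : Finset (Fin n)).offDiag | c.1.Adj p.1 p.2} := by
  have h : 0 < #{v | v ∈ c.1.support} := by rwa [Copy.card_support hiso c]
  obtain ⟨v, hv⟩ := card_pos.1 h
  obtain ⟨w, hw⟩ := (SimpleGraph.mem_support _).1 (mem_filter.1 hv).2
  exact card_pos.2 ⟨(v, w), by simp [hw, hw.ne]⟩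

theorem card_le_mul_card_filter_adj (hk : 0 < k) (hiso : ∀ v, (H.neighborSet v).Nonempty)
    {u v : Fin n} (huv : u ≠ v) :
    Fintype.card (Copy H n) ≤ n * (n - 1) * #{c : Copy H n | c.1.Adj u v} := by
  rw [card_offDiag_mul_card_filter (fun c u v => c.1.Adj u v)
    (fun σ c u v => Copy.perm_adj σ c u v) huv, ← card_univ, card_eq_sum_ones]
  exact sum_le_sum fun c _ => Copy.one_le_card_adj hk hiso c

theorem mul_card_filter_adj_le (hiso : ∀ v, (H.neighborSet v).Nonempty)
    {u v : Fin n} (huv : u ≠ v) :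
    n * (n - 1) * #{c : Copy H n | c.1.Adj u v} ≤ k ^ 2 * Fintype.card (Copy H n) := by
  rw [card_offDiag_mul_card_filter (fun c u v => c.1.Adj u v)
    (fun σ c u v => Copy.perm_adj σ c u v) huv]
  refine (sum_le_card_nsmul _ _ _ fun c _ => Copy.card_adj_le hiso c).trans (le_of_eq ?_)
  rw [card_univ, smul_eq_mul, mul_comm]

theorem nonempty_copy (hkn : k ≤ n) : Nonempty (Copy H n) :=
  ⟨⟨H.map (Fin.castLEEmb hkn), _, rfl⟩⟩

theorem exists_copy_adj (hk : 0 < k) (hiso : ∀ v, (H.neighborSet v).Nonempty) (hkn : k ≤ n)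
    {u v : Fin n} (huv : u ≠ v) : ∃ c : Copy H n, c.1.Adj u v := by
  have h1 := card_le_mul_card_filter_adj hk hiso huv
  have h2 : 0 < Fintype.card (Copy H n) := Fintype.card_pos_iff.2 (nonempty_copy hkn)
  have h3 : 0 < #{c : Copy H n | c.1.Adj u v} := by
    by_contra h
    simp only [not_lt, nonpos_iff_eq_zero] at h
    rw [h] at h1
    omega
  obtain ⟨c, hc⟩ := card_pos.1 h3
  exact ⟨c, by simpa using hc⟩

theorem mul_le_card_copy (hk : 0 < k) (hiso : ∀ v, (H.neighborSet v).Nonempty) (hkn : k ≤ n) :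
    n * (n - 1) ≤ k ^ 2 * Fintype.card (Copy H n) := by
  rcases Nat.lt_or_ge n 2 with hn | hn
  · have : n - 1 = 0 := by omega
    simp [this]
  have huv : (⟨0, by omega⟩ : Fin n) ≠ ⟨1, by omega⟩ := by simp
  obtain ⟨c, hc⟩ := exists_copy_adj hk hiso hkn huv
  refine le_trans ?_ (mul_card_filter_adj_le hiso huv)
  exact Nat.le_mul_of_pos_right _ (card_pos.2 ⟨c, by simpa using hc⟩)

/-- The copies with an edge between `S` and its complement. -/
noncomputable def crossing (H : SimpleGraph (Fin k)) (S : Finset (Fin n)) : Finset (Copy H n) :=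
  {c | ∃ u ∈ S, ∃ v ∉ S, c.1.Adj u v}

theorem card_inter_support_le (S : Finset (Fin n)) (c : Copy H n) :
    #{v ∈ S | v ∈ c.1.support} ≤ (if c ∈ crossing H S then 1 else 0) +
      #{p ∈ S.offDiag | p.1 ∈ c.1.support ∧ p.2 ∈ c.1.support} := by
  set T := S.filter fun v => v ∈ c.1.support with hT
  have h : (S.offDiag.filter fun p => p.1 ∈ c.1.support ∧ p.2 ∈ c.1.support) = T.offDiag := by
    ext p
    simp only [hT, mem_filter, mem_offDiag]
    tauto
  rw [h, offDiag_card]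
  rcases Nat.lt_or_ge 1 #T with h1 | h1
  · have : 2 * #T ≤ #T * #T := Nat.mul_le_mul_right _ h1
    omega
  rcases Nat.eq_zero_or_pos #T with h0 | h0
  · omega
  have hcard : #T = 1 := by omega
  obtain ⟨v, hv⟩ := card_eq_one.1 hcard
  have hvT : v ∈ T := by rw [hv]; exact mem_singleton_self v
  obtain ⟨hvS, hvc⟩ := mem_filter.1 hvT
  obtain ⟨w, hw⟩ := (SimpleGraph.mem_support _).1 hvc
  have hwS : w ∉ S := by
    intro hwS
    have : w ∈ T := mem_filter.2 ⟨hwS, (SimpleGraph.mem_support _).2 ⟨v, hw.symm⟩⟩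
    rw [hv, mem_singleton] at this
    exact hw.ne this.symm
  have hc : c ∈ crossing H S := by
    simp only [crossing, mem_filter, mem_univ, true_and]
    exact ⟨v, hvS, w, hwS, hw⟩
  rw [if_pos hc]
  omega

theorem crossing_lower_of_small (hn : 2 ≤ n) (hk : 0 < k)
    (hiso : ∀ v, (H.neighborSet v).Nonempty) (S : Finset (Fin n)) :
    (Fintype.card (Copy H n) : ℝ) * (#S * k / n) * (1 - (#S - 1) * (k - 1) / (n - 1)) ≤
      #(crossing H S) := by
  set N : ℝ := (Fintype.card (Copy H n) : ℝ) with hN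
  have hn0 : (n : ℝ) ≠ 0 := by
    have : n ≠ 0 := by omega
    exact_mod_cast this
  have hn1 : (n : ℝ) - 1 ≠ 0 := by
    have : (2 : ℝ) ≤ n := by exact_mod_cast hn
    linarith
  have hsum := sum_le_sum fun (c : Copy H n) (_ : c ∈ univ) => card_inter_support_le S c
  have h1 : ∑ c : Copy H n, #{v ∈ S | v ∈ c.1.support} =
      ∑ v ∈ S, #{c : Copy H n | v ∈ c.1.support} := by
    simp only [card_filter]
    rw [sum_comm]
  have h2 : ∑ c : Copy H n, #{p ∈ S.offDiag | p.1 ∈ c.1.support ∧ p.2 ∈ c.1.support} =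
      ∑ p ∈ S.offDiag, #{c : Copy H n | p.1 ∈ c.1.support ∧ p.2 ∈ c.1.support} := by
    simp only [card_filter]
    rw [sum_comm]
  have hA : ∀ v ∈ S, ((#{c : Copy H n | v ∈ c.1.support} : ℕ) : ℝ) = k * N / n := by
    intro v _
    rw [eq_div_iff hn0, mul_comm, hN]
    exact_mod_cast mul_card_filter_mem_support hiso v
  have hB : ∀ p ∈ S.offDiag, ((#{c : Copy H n | p.1 ∈ c.1.support ∧ p.2 ∈ c.1.support} : ℕ) : ℝ) =
      k * (k - 1) * N / (n * (n - 1)) := by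
    intro p hp
    rw [eq_div_iff (mul_ne_zero hn0 hn1), mul_comm, hN]
    have := mul_card_filter_pair_mem_support (H := H) hiso (mem_offDiag.1 hp).2.2
    have h3 : (((n * (n - 1) * #{c : Copy H n | p.1 ∈ c.1.support ∧ p.2 ∈ c.1.support} : ℕ)) : ℝ) =
      ((k * (k - 1) * Fintype.card (Copy H n) : ℕ) : ℝ) := by rw [this]
    push_cast [Nat.cast_sub (show 1 ≤ n by omega), Nat.cast_sub hk] at h3
    linarith
  rw [sum_add_distrib, h1, h2, ← card_filter, filter_univ_mem] at hsum
  have hsum' : ((∑ v ∈ S, #{c : Copy H n | v ∈ c.1.support} : ℕ) : ℝ) ≤ ((#(crossing H S) +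
    ∑ p ∈ S.offDiag, #{c : Copy H n | p.1 ∈ c.1.support ∧ p.2 ∈ c.1.support} : ℕ) : ℝ) := by
    exact_mod_cast hsum
  push_cast at hsum'
  rw [sum_congr rfl hA, sum_congr rfl hB, sum_const, sum_const, nsmul_eq_mul, nsmul_eq_mul,
    offDiag_card, Nat.cast_sub (Nat.le_mul_self _)] at hsum'
  push_cast at hsum'
  refine le_trans (le_of_eq ?_) (sub_le_iff_le_add.2 hsum')
  field_simp

theorem crossing_lower_of_large (hn : 2 ≤ n) (hk : 0 < k)
    (hiso : ∀ v, (H.neighborSet v).Nonempty) (S : Finset (Fin n)) (hS : 2 * #S ≤ n) :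
    (Fintype.card (Copy H n) : ℝ) * (#S / (2 * k ^ 2 * n)) ≤ #(crossing H S) := by
  have hdc : ∑ p ∈ S ×ˢ Sᶜ, #{c : Copy H n | c.1.Adj p.1 p.2} ≤ #(crossing H S) * k ^ 2 := by
    have h1 : ∑ p ∈ S ×ˢ Sᶜ, #{c : Copy H n | c.1.Adj p.1 p.2} =
        ∑ c : Copy H n, #{p ∈ S ×ˢ Sᶜ | c.1.Adj p.1 p.2} := by
      simp only [card_filter]
      rw [sum_comm]
    have h2 : ∑ c : Copy H n, #{p ∈ S ×ˢ Sᶜ | c.1.Adj p.1 p.2} =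
        ∑ c ∈ crossing H S, #{p ∈ S ×ˢ Sᶜ | c.1.Adj p.1 p.2} := by
      refine (sum_subset (subset_univ _) fun c _ hc => ?_).symm
      rw [card_eq_zero, filter_eq_empty_iff]
      rintro ⟨u, v⟩ huv hadj
      rw [mem_product, mem_compl] at huv
      exact hc (mem_filter.2 ⟨mem_univ _, u, huv.1, v, huv.2, hadj⟩)
    rw [h1, h2, ← smul_eq_mul]
    refine sum_le_card_nsmul _ _ _ fun c _ => (card_le_card fun p hp => ?_).trans
      (Copy.card_adj_le hiso c)
    rw [mem_filter] at hp ⊢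
    exact ⟨by simp [hp.2.ne], hp.2⟩
  set N : ℝ := (Fintype.card (Copy H n) : ℝ) with hN
  have hn2 : (2 : ℝ) ≤ n := by exact_mod_cast hn
  have hk0 : (0 : ℝ) < k := by exact_mod_cast hk
  have hN0 : 0 ≤ N := Nat.cast_nonneg _
  have hS' : 2 * (#S : ℝ) ≤ n := by exact_mod_cast hS
  have hS0 : (0 : ℝ) ≤ #S := Nat.cast_nonneg _
  have hD : ∀ p ∈ S ×ˢ Sᶜ, N / n ^ 2 ≤ ((#{c : Copy H n | c.1.Adj p.1 p.2} : ℕ) : ℝ) := by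
    intro p hp
    rw [mem_product, mem_compl] at hp
    have hne : p.1 ≠ p.2 := fun h => hp.2 (h ▸ hp.1)
    have h := card_le_mul_card_filter_adj (H := H) hk hiso hne
    have h' : Fintype.card (Copy H n) ≤ n ^ 2 * #{c : Copy H n | c.1.Adj p.1 p.2} := by
      refine h.trans (Nat.mul_le_mul_right _ ?_)
      rw [sq]
      exact Nat.mul_le_mul_left _ (Nat.sub_le _ _)
    rw [div_le_iff₀ (by positivity), mul_comm, hN]
    exact_mod_cast h'
  have hdc' : ∑ p ∈ S ×ˢ Sᶜ, ((#{c : Copy H n | c.1.Adj p.1 p.2} : ℕ) : ℝ) ≤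
      #(crossing H S) * k ^ 2 := by exact_mod_cast hdc
  have h3 := (card_nsmul_le_sum _ _ _ hD).trans hdc'
  have hcompl : (#Sᶜ : ℝ) = n - #S := by
    rw [card_compl, Fintype.card_fin, Nat.cast_sub (by omega)]
  rw [nsmul_eq_mul, card_product, Nat.cast_mul, hcompl] at h3
  have h4 : (#S * (n / 2) : ℝ) * (N / n ^ 2) ≤ #S * (n - #S) * (N / n ^ 2) := by
    refine mul_le_mul_of_nonneg_right (mul_le_mul_of_nonneg_left (by linarith) hS0) (by positivity)
  have h5 : (#S * (n / 2) : ℝ) * (N / n ^ 2) / k ^ 2 = N * (#S / (2 * k ^ 2 * n)) := by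
    field_simp
  rw [← h5, div_le_iff₀ (by positivity)]
  exact h4.trans h3

end Copies

section HittingTimes

variable {k n : ℕ} {H : SimpleGraph (Fin k)}

theorem procGraph_adj (ω : ProcSample H n) (i : ℕ) (u v : Fin n) :
    (procGraph ω i).Adj u v ↔
      ∃ j : Fin (numCopies H n), (j : ℕ) < i ∧ (ω j).1.Adj u v := by
  rw [procGraph, SimpleGraph.iSup_adj]
  refine exists_congr fun j => ?_
  by_cases h : (j : ℕ) < i <;> simp [h]

theorem one_le_ncard_neighborSet_iff (ω : ProcSample H n) (i : ℕ) (v : Fin n) :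
    1 ≤ ((procGraph ω i).neighborSet v).ncard ↔
      ∃ j : Fin (numCopies H n), (j : ℕ) < i ∧ v ∈ (ω j).1.support := by
  rw [Nat.one_le_iff_ne_zero, ← Nat.pos_iff_ne_zero, Set.ncard_pos (Set.toFinite _)]
  constructor
  · rintro ⟨w, hw⟩
    obtain ⟨j, hj, hadj⟩ := (procGraph_adj ω i v w).1 hw
    exact ⟨j, hj, (SimpleGraph.mem_support _).2 ⟨w, hadj⟩⟩
  · rintro ⟨j, hj, hs⟩
    obtain ⟨w, hadj⟩ := (SimpleGraph.mem_support _).1 hs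
    exact ⟨w, (procGraph_adj ω i v w).2 ⟨j, hj, hadj⟩⟩

/-- A finite disconnected graph has a vertex set of at most half the size without outgoing
edges. -/
theorem exists_small_closed_set (hn : 2 ≤ n) (G : SimpleGraph (Fin n)) (hG : ¬ G.Connected) :
    ∃ S : Finset (Fin n), S.Nonempty ∧ 2 * #S ≤ n ∧ ∀ u ∈ S, ∀ v ∉ S, ¬ G.Adj u v := by
  have hne : Nonempty (Fin n) := ⟨⟨0, by omega⟩⟩
  have hpre : ¬ G.Preconnected := fun h => hG ⟨h⟩
  simp only [SimpleGraph.Preconnected, not_forall] at hpre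
  obtain ⟨a, b, hab⟩ := hpre
  have hcl : ∀ u ∈ univ.filter fun x => G.Reachable a x,
      ∀ v ∉ univ.filter fun x => G.Reachable a x, ¬ G.Adj u v := by
    intro u hu v hv hadj
    simp only [mem_filter, mem_univ, true_and] at hu hv
    exact hv (hu.trans hadj.reachable)
  set S := univ.filter fun x => G.Reachable a x with hS
  have hcard : #S + #Sᶜ = n := by simp
  by_cases h : 2 * #S ≤ n
  · exact ⟨S, ⟨a, by simp [hS]⟩, h, hcl⟩
  · refine ⟨Sᶜ, ⟨b, by simp [hS, hab]⟩, by omega, ?_⟩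
    intro u hu v hv hadj
    exact hcl v (by simpa using hv) u (by simpa using hu) hadj.symm

/-- What goes wrong if the two hitting times differ. -/
theorem bad_event_of_tauConn_ne (hn : 2 ≤ n) (m M : ℕ) (ω : ProcSample H n)
    (hne : tauConn ω ≠ tauDeg 1 ω) :
    ((∀ v : Fin n, ¬ ∀ i : Fin (numCopies H n), (i : ℕ) < m →
        ω i ∉ univ.filter fun c : Copy H n => v ∈ c.1.support) ∨
      ∃ v ∈ (univ : Finset (Fin n)), ∀ i : Fin (numCopies H n), (i : ℕ) < M →
        ω i ∉ univ.filter fun c : Copy H n => v ∈ c.1.support) ∨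
    ∃ p ∈ (univ : Finset (Fin n)).offDiag,
      ∃ S ∈ univ.filter fun S : Finset (Fin n) => p.1 ∈ S ∧ p.2 ∈ S ∧ 2 * #S ≤ n,
      ∃ c ∈ univ.filter fun c : Copy H n => c.1.Adj p.1 p.2,
      ∃ j : Fin (numCopies H n), (j : ℕ) < M ∧ ω j = c ∧
        ∀ i : Fin (numCopies H n), (i : ℕ) < m → ω i ∉ crossing H S := by
  rw [or_iff_not_imp_left]
  intro hnot
  simp only [mem_filter, mem_univ, true_and, not_or, not_forall, not_exists, not_not,
    exists_prop, not_and] at hnot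
  obtain ⟨⟨v₀, hv₀⟩, hM⟩ := hnot
  have hMmem : M ∈ {i : ℕ | ∀ v : Fin n, 1 ≤ ((procGraph ω i).neighborSet v).ncard} := fun v =>
    (one_le_ncard_neighborSet_iff ω M v).2 (hM v)
  have htM : tauDeg 1 ω ≤ M := Nat.sInf_le hMmem
  have htmem : ∀ v : Fin n, 1 ≤ ((procGraph ω (tauDeg 1 ω)).neighborSet v).ncard :=
    Nat.sInf_mem ⟨M, hMmem⟩
  have hmt : m ≤ tauDeg 1 ω := by
    by_contra h
    obtain ⟨j, hj, hs⟩ := (one_le_ncard_neighborSet_iff ω _ v₀).1 (htmem v₀)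
    exact hv₀ j (by omega) hs
  have hconn : ¬ (procGraph ω (tauDeg 1 ω)).Connected := by
    intro hc
    refine hne (le_antisymm (Nat.sInf_le hc) (Nat.sInf_le fun v => ?_))
    have hc' : (procGraph ω (tauConn ω)).Connected :=
      Nat.sInf_mem (s := {i | (procGraph ω i).Connected}) ⟨_, hc⟩
    have : Nontrivial (Fin n) := Fin.nontrivial_iff_two_le.2 hn
    obtain ⟨w, hw⟩ := hc'.preconnected.exists_adj_of_nontrivial v
    exact (Set.ncard_pos (Set.toFinite _)).2 ⟨w, hw⟩
  obtain ⟨S, ⟨u, hu⟩, hS, hcl⟩ := exists_small_closed_set hn _ hconn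
  obtain ⟨w, hw⟩ := (Set.ncard_pos (Set.toFinite _)).1 (htmem u)
  obtain ⟨j, hj, hadj⟩ := (procGraph_adj ω _ u w).1 hw
  have hwS : w ∈ S := by
    by_contra h
    exact hcl u hu w h hw
  refine ⟨(u, w), by simp [hadj.ne], S, by simp [hu, hwS, hS], ω j, by simp [hadj], j,
    by omega, rfl, fun i hi hcr => ?_⟩
  simp only [crossing, mem_filter, mem_univ, true_and] at hcr
  obtain ⟨x, hx, y, hy, hxy⟩ := hcr
  exact hcl x hx y hy ((procGraph_adj ω _ x y).2 ⟨i, by omega, hxy⟩)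

theorem procProb_eq_unifProb (P : ProcSample H n → Prop) : procProb H n P = unifProb P := by
  rw [procProb, unifProb_eq, Nat.card_eq_fintype_card, Nat.card_eq_fintype_card,
    Fintype.card_subtype]

theorem card_copy : Fintype.card (Copy H n) = numCopies H n :=
  Nat.card_eq_fintype_card.symm

theorem avoidProb_congr {N : ℕ} {α : Type*} [Fintype α] [DecidableEq α]
    (hN : Fintype.card α = N) {B C : Finset α} (h : #B = #C) {m : ℕ} (hm : m ≤ N) :
    avoidProb N B m = avoidProb N C m := by
  induction m with
  | zero => rw [avoidProb_zero hN, avoidProb_zero hN]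
  | succ m ih =>
    have hmN : (m : ℝ) < N := by exact_mod_cast hm
    have h1 := avoidProb_succ (N := N) B hm
    rw [ih (by omega), h, ← avoidProb_succ C hm] at h1
    exact mul_right_cancel₀ (by linarith) h1

/-- The second moment bound for the absence of isolated vertices. -/
theorem unifProb_no_isolated_le (hn : 2 ≤ n) (hk : 0 < k)
    (hiso : ∀ v, (H.neighborSet v).Nonempty) (hkn : k ≤ n) {m : ℕ} (hm : m ≤ numCopies H n)
    {q : ℝ} (hq0 : 0 ≤ q) (hq : q ≤ 1 / 2)
    (hqN : (k : ℝ) * numCopies H n / n ≤ q * (numCopies H n - m)) :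
    unifProb (fun ω : ProcSample H n => ∀ v : Fin n, ¬ ∀ i : Fin (numCopies H n), (i : ℕ) < m →
        ω i ∉ univ.filter fun c : Copy H n => v ∈ c.1.support) ≤
      1 / (1 + n * Real.exp (-(m * (q + 2 * q ^ 2)))) := by
  have hN := card_copy (H := H) (n := n)
  have hne : Nonempty (ProcSample H n) := ⟨(Fintype.equivFinOfCardEq hN).symm⟩
  set N := numCopies H n with hNdef
  have hn2 : (2 : ℝ) ≤ n := by exact_mod_cast hn
  have hn0 : (n : ℝ) ≠ 0 := by linarith
  have hkn' : (k : ℝ) ≤ n := by exact_mod_cast hkn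
  have hA : ∀ v : Fin n, ((#{c : Copy H n | v ∈ c.1.support} : ℕ) : ℝ) = k * N / n := by
    intro v
    rw [eq_div_iff hn0, mul_comm, ← hN]
    exact_mod_cast mul_card_filter_mem_support hiso v
  let v₀ : Fin n := ⟨0, by omega⟩
  set p := avoidProb N (univ.filter fun c : Copy H n => v₀ ∈ c.1.support) m with hp
  have hlow : Real.exp (-(m * (q + 2 * q ^ 2))) ≤ p :=
    exp_le_avoidProb hN _ hq0 hq (by rw [hA]; exact hqN) le_rfl hm
  have key := unifProb_forall_not_mul_le
    (fun (v : Fin n) (ω : ProcSample H n) => ∀ i : Fin N, (i : ℕ) < m →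
        ω i ∉ univ.filter fun c : Copy H n => v ∈ c.1.support) p
    (fun v => avoidProb_congr hN (by exact_mod_cast (hA v).trans (hA v₀).symm) hm)
    (by
      intro u v huv
      have hcongr : p = avoidProb N (univ.filter fun c : Copy H n => u ∈ c.1.support) m :=
        avoidProb_congr hN (by exact_mod_cast (hA v₀).trans (hA u).symm) hm
      have hunion := card_union_add_card_inter (univ.filter fun c : Copy H n => u ∈ c.1.support)
        (univ.filter fun c : Copy H n => v ∈ c.1.support)
      have hinter : (univ.filter fun c : Copy H n => u ∈ c.1.support) ∩
          (univ.filter fun c : Copy H n => v ∈ c.1.support) =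
          univ.filter fun c : Copy H n => u ∈ c.1.support ∧ v ∈ c.1.support := by
        ext c; simp
      have hB : (n : ℝ) * (n - 1) * #{c : Copy H n | u ∈ c.1.support ∧ v ∈ c.1.support} =
          k * (k - 1) * N := by
        have h := congrArg (Nat.cast (R := ℝ))
          (mul_card_filter_pair_mem_support (H := H) hiso huv)
        push_cast [Nat.cast_sub (show 1 ≤ n by omega), Nat.cast_sub hk] at h
        rw [← hN]
        exact_mod_cast h
      rw [hinter] at hunion
      have hunion' := congrArg (Nat.cast (R := ℝ)) hunion
      push_cast at hunion'
      rw [hcongr]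
      refine le_trans (unifProb_mono fun ω hω i hi => ?_)
        (avoidProb_le_sq hN (univ.filter fun c : Copy H n => u ∈ c.1.support)
          ((univ.filter fun c : Copy H n => u ∈ c.1.support) ∪
            (univ.filter fun c : Copy H n => v ∈ c.1.support)) ?_ hm)
      · rw [mem_union, not_or]
        exact ⟨hω.1 i hi, hω.2 i hi⟩
      · have h1 : (2 * #{c : Copy H n | u ∈ c.1.support} -
            #((univ.filter fun c : Copy H n => u ∈ c.1.support) ∪
            (univ.filter fun c : Copy H n => v ∈ c.1.support)) : ℝ) =
            k * (k - 1) * N / (n * (n - 1)) := by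
          rw [eq_div_iff (mul_ne_zero hn0 (by linarith)), ← hB]
          rw [hA u, hA v] at hunion'
          rw [hA u]
          linear_combination (-n * (n - 1) : ℝ) * hunion'
        have hN0 : (0 : ℝ) ≤ N := Nat.cast_nonneg _
        have hk0 : (0 : ℝ) ≤ k := Nat.cast_nonneg _
        rw [h1, hA u, div_pow, ← mul_div_assoc, div_le_div_iff₀ (by nlinarith) (by positivity)]
        have h2 : 0 ≤ (k * N ^ 2 * n : ℝ) * (n - k) :=
          mul_nonneg (by positivity) (by linarith)
        nlinarith)
  rw [Fintype.card_fin] at key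
  have hpos : 0 < 1 + n * Real.exp (-(m * (q + 2 * q ^ 2))) := by positivity
  rw [le_div_iff₀ hpos]
  refine le_trans (mul_le_mul_of_nonneg_left ?_ (unifProb_nonneg _)) key
  gcongr

theorem crossing_nonempty (hn : 2 ≤ n) (hk : 0 < k) (hiso : ∀ v, (H.neighborSet v).Nonempty)
    (hkn : k ≤ n) {S : Finset (Fin n)} (hS : S.Nonempty) (hSn : 2 * #S ≤ n) :
    (crossing H S).Nonempty := by
  have h := crossing_lower_of_large hn hk hiso S hSn
  have hN : (0 : ℝ) < Fintype.card (Copy H n) := by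
    exact_mod_cast Fintype.card_pos_iff.2 (nonempty_copy hkn)
  have hS' : (0 : ℝ) < #S := by exact_mod_cast hS.card_pos
  have hn' : (0 : ℝ) < n := by
    have : 0 < n := by omega
    exact_mod_cast this
  have hk' : (0 : ℝ) < k := by exact_mod_cast hk
  have : (0 : ℝ) < #(crossing H S) := lt_of_lt_of_le (by positivity) h
  exact card_pos.1 (by exact_mod_cast this)

theorem unifProb_exists_closed_le (hn : 2 ≤ n) (hk : 0 < k)
    (hiso : ∀ v, (H.neighborSet v).Nonempty) (hkn : k ≤ n) {m : ℕ} (hm : m ≤ numCopies H n)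
    (M : ℕ) {W : ℝ}
    (hW : ∀ u v : Fin n, u ≠ v →
      ∑ S with u ∈ S ∧ v ∈ S ∧ 2 * #S ≤ n,
        Real.exp (-(#(crossing H S) * m / numCopies H n)) ≤ W) :
    unifProb (fun ω : ProcSample H n => ∃ p ∈ (univ : Finset (Fin n)).offDiag,
      ∃ S ∈ univ.filter fun S : Finset (Fin n) => p.1 ∈ S ∧ p.2 ∈ S ∧ 2 * #S ≤ n,
      ∃ c ∈ univ.filter fun c : Copy H n => c.1.Adj p.1 p.2,
      ∃ j : Fin (numCopies H n), (j : ℕ) < M ∧ ω j = c ∧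
        ∀ i : Fin (numCopies H n), (i : ℕ) < m → ω i ∉ crossing H S) ≤
    k ^ 2 * M * Real.exp 2 * W := by
  have hN := card_copy (H := H) (n := n)
  have hNpos : (0 : ℝ) < numCopies H n := by
    rw [← hN]
    exact_mod_cast Fintype.card_pos_iff.2 (nonempty_copy hkn)
  set N := numCopies H n with hNdef
  have hn2 : (2 : ℝ) ≤ n := by exact_mod_cast hn
  have hnn : (0 : ℝ) < n * (n - 1) := by nlinarith
  have hpair : ∀ p ∈ (univ : Finset (Fin n)).offDiag,
      ∑ S with p.1 ∈ S ∧ p.2 ∈ S ∧ 2 * #S ≤ n, ∑ c : Copy H n with c.1.Adj p.1 p.2,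
        unifProb (fun ω : ProcSample H n => ∃ j : Fin N, (j : ℕ) < M ∧ ω j = c ∧
          ∀ i : Fin N, (i : ℕ) < m → ω i ∉ crossing H S) ≤
      k ^ 2 * M * Real.exp 2 * W / (n * (n - 1)) := by
    intro p hp
    have hne : p.1 ≠ p.2 := (mem_offDiag.1 hp).2.2
    have hD : ((#{c : Copy H n | c.1.Adj p.1 p.2} : ℕ) : ℝ) ≤ k ^ 2 * N / (n * (n - 1)) := by
      rw [le_div_iff₀ hnn, mul_comm]
      have h := (Nat.cast_le (α := ℝ)).2 (mul_card_filter_adj_le (H := H) hiso hne)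
      push_cast [Nat.cast_sub (show 1 ≤ n by omega)] at h
      rw [← hN]
      exact_mod_cast h
    have hS : ∀ S ∈ univ.filter fun S : Finset (Fin n) => p.1 ∈ S ∧ p.2 ∈ S ∧ 2 * #S ≤ n,
        ∑ c : Copy H n with c.1.Adj p.1 p.2,
        unifProb (fun ω : ProcSample H n => ∃ j : Fin N, (j : ℕ) < M ∧ ω j = c ∧
          ∀ i : Fin N, (i : ℕ) < m → ω i ∉ crossing H S) ≤
        k ^ 2 * M * Real.exp 2 / (n * (n - 1)) * Real.exp (-(#(crossing H S) * m / N)) := by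
      intro S hS
      simp only [mem_filter, mem_univ, true_and] at hS
      have hcr : (crossing H S).Nonempty := crossing_nonempty hn hk hiso hkn ⟨_, hS.1⟩ hS.2.2
      refine (sum_le_card_nsmul _ _ _ fun c _ =>
        unifProb_early_and_avoid_le hN (crossing H S) hcr c hm M).trans ?_
      rw [nsmul_eq_mul, sub_eq_add_neg, Real.exp_add]
      refine (mul_le_mul_of_nonneg_right hD (by positivity)).trans (le_of_eq ?_)
      field_simp
    refine (sum_le_sum hS).trans ?_
    rw [← mul_sum, show (k : ℝ) ^ 2 * M * Real.exp 2 * W / (n * (n - 1)) =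
      k ^ 2 * M * Real.exp 2 / (n * (n - 1)) * W by ring]
    exact mul_le_mul_of_nonneg_left (hW p.1 p.2 hne) (div_nonneg (by positivity) hnn.le)
  refine (unifProb_exists_le _ _).trans ?_
  refine (sum_le_sum fun p _ => (unifProb_exists_le _ _).trans
    (sum_le_sum fun S _ => unifProb_exists_le _ _)).trans ?_
  refine (sum_le_card_nsmul _ _ _ hpair).trans (le_of_eq ?_)
  rw [nsmul_eq_mul, offDiag_card, card_univ, Fintype.card_fin, Nat.cast_sub (Nat.le_mul_self _)]
  push_cast
  have : (n : ℝ) * n - n = n * (n - 1) := by ring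
  rw [this, mul_div_cancel₀ _ hnn.ne']

theorem one_sub_le_procProb_tauConn_eq (hn : 2 ≤ n) (hk : 0 < k)
    (hiso : ∀ v, (H.neighborSet v).Nonempty) (hkn : k ≤ n) {m M : ℕ} (hm : m ≤ numCopies H n)
    (hM : M ≤ numCopies H n) {q : ℝ} (hq0 : 0 ≤ q) (hq : q ≤ 1 / 2)
    (hqN : (k : ℝ) * numCopies H n / n ≤ q * (numCopies H n - m)) {W : ℝ}
    (hW : ∀ u v : Fin n, u ≠ v →
      ∑ S with u ∈ S ∧ v ∈ S ∧ 2 * #S ≤ n,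
        Real.exp (-(#(crossing H S) * m / numCopies H n)) ≤ W) :
    1 - (1 / (1 + n * Real.exp (-(m * (q + 2 * q ^ 2)))) + n * Real.exp (-(k * M / n)) +
      k ^ 2 * M * Real.exp 2 * W) ≤ procProb H n (fun ω => tauConn ω = tauDeg 1 ω) := by
  have hN := card_copy (H := H) (n := n)
  have hne : Nonempty (ProcSample H n) := ⟨(Fintype.equivFinOfCardEq hN).symm⟩
  have hn2 : (2 : ℝ) ≤ n := by exact_mod_cast hn
  have hNpos : (0 : ℝ) < numCopies H n := by
    rw [← hN]
    exact_mod_cast Fintype.card_pos_iff.2 (nonempty_copy hkn)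
  rw [procProb_eq_unifProb]
  have hadd := unifProb_add_unifProb_not (fun ω : ProcSample H n => tauConn ω = tauDeg 1 ω)
  have hbad := unifProb_mono fun ω hω => bad_event_of_tauConn_ne (H := H) hn m M ω hω
  have h1 := unifProb_no_isolated_le hn hk hiso hkn hm hq0 hq hqN
  have h3 := unifProb_exists_closed_le hn hk hiso hkn hm M hW
  have h2 : unifProb (fun ω : ProcSample H n => ∃ v ∈ (univ : Finset (Fin n)),
      ∀ i : Fin (numCopies H n), (i : ℕ) < M →
        ω i ∉ univ.filter fun c : Copy H n => v ∈ c.1.support) ≤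
      n * Real.exp (-(k * M / n)) := by
    refine (unifProb_exists_le _ _).trans ?_
    refine (sum_le_card_nsmul _ _ (Real.exp (-(k * M / n))) fun v _ => ?_).trans (le_of_eq ?_)
    · refine (avoidProb_le_exp hN _ hM).trans (le_of_eq ?_)
      have hA : ((#{c : Copy H n | v ∈ c.1.support} : ℕ) : ℝ) = k * numCopies H n / n := by
        rw [eq_div_iff (by linarith), mul_comm, ← hN]
        exact_mod_cast mul_card_filter_mem_support hiso v
      rw [hA]
      congr 2
      field_simp
    · rw [nsmul_eq_mul, card_univ, Fintype.card_fin]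
  have h4 := unifProb_or_le
    (fun ω : ProcSample H n => (∀ v : Fin n, ¬ ∀ i : Fin (numCopies H n), (i : ℕ) < m →
        ω i ∉ univ.filter fun c : Copy H n => v ∈ c.1.support) ∨
      ∃ v ∈ (univ : Finset (Fin n)), ∀ i : Fin (numCopies H n), (i : ℕ) < M →
        ω i ∉ univ.filter fun c : Copy H n => v ∈ c.1.support)
    (fun ω : ProcSample H n => ∃ p ∈ (univ : Finset (Fin n)).offDiag,
      ∃ S ∈ univ.filter fun S : Finset (Fin n) => p.1 ∈ S ∧ p.2 ∈ S ∧ 2 * #S ≤ n,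
      ∃ c ∈ univ.filter fun c : Copy H n => c.1.Adj p.1 p.2,
      ∃ j : Fin (numCopies H n), (j : ℕ) < M ∧ ω j = c ∧
        ∀ i : Fin (numCopies H n), (i : ℕ) < m → ω i ∉ crossing H S)
  have h5 := unifProb_or_le
    (fun ω : ProcSample H n => ∀ v : Fin n, ¬ ∀ i : Fin (numCopies H n), (i : ℕ) < m →
        ω i ∉ univ.filter fun c : Copy H n => v ∈ c.1.support)
    (fun ω : ProcSample H n => ∃ v ∈ (univ : Finset (Fin n)),
      ∀ i : Fin (numCopies H n), (i : ℕ) < M →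
        ω i ∉ univ.filter fun c : Copy H n => v ∈ c.1.support)
  linarith

end HittingTimes

section SubsetSums

variable {n : ℕ}

theorem sum_pow_card_filter_pair_le {u v : Fin n} (huv : u ≠ v) {x : ℝ} (hx : 0 ≤ x) :
    ∑ S with u ∈ S ∧ v ∈ S, x ^ #S ≤ x ^ 2 * Real.exp (n * x) := by
  have h : ∑ S with u ∈ S ∧ v ∈ S, x ^ #S ≤
      ∑ T : Finset (Fin n), x ^ 2 * x ^ #T := by
    have hinj : Set.InjOn (fun S : Finset (Fin n) => (S.erase u).erase v)
        (univ.filter fun S : Finset (Fin n) => u ∈ S ∧ v ∈ S : Finset (Finset (Fin n))) := by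
      intro S hS T hT hST
      simp only [mem_coe, mem_filter, mem_univ, true_and] at hS hT
      dsimp only at hST
      have h1 : ∀ R : Finset (Fin n), u ∈ R → v ∈ R →
          insert u (insert v ((R.erase u).erase v)) = R := fun R hu hv => by
        rw [insert_erase (mem_erase.2 ⟨huv.symm, hv⟩), insert_erase hu]
      rw [← h1 S hS.1 hS.2, ← h1 T hT.1 hT.2, hST]
    calc ∑ S with u ∈ S ∧ v ∈ S, x ^ #S
        = ∑ S with u ∈ S ∧ v ∈ S, x ^ 2 * x ^ #(((S : Finset (Fin n)).erase u).erase v) := by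
          refine sum_congr rfl fun S hS => ?_
          simp only [mem_filter, mem_univ, true_and] at hS
          rw [← pow_add, add_comm, ← card_erase_add_one hS.1,
            ← card_erase_add_one (mem_erase.2 ⟨huv.symm, hS.2⟩)]
      _ = ∑ T ∈ (univ.filter fun S : Finset (Fin n) => u ∈ S ∧ v ∈ S).image
            (fun S : Finset (Fin n) => (S.erase u).erase v), x ^ 2 * x ^ #T :=
          (sum_image (f := fun T => x ^ 2 * x ^ #T) hinj).symm
      _ ≤ _ := sum_le_sum_of_subset_of_nonneg (subset_univ _) fun _ _ _ => by positivity
  refine h.trans ?_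
  rw [← mul_sum]
  refine mul_le_mul_of_nonneg_left ?_ (by positivity)
  have := Fintype.sum_pow_mul_eq_add_pow (Fin n) x 1
  simp only [one_pow, mul_one, Fintype.card_fin] at this
  rw [this, Real.exp_nat_mul]
  exact pow_le_pow_left₀ (by positivity) (Real.add_one_le_exp x) n

theorem sum_pow_card_filter_large_le {y : ℝ} (hy : 0 ≤ y) (a : ℝ) :
    ∑ S : Finset (Fin n) with a ≤ #S, y ^ #S ≤ Real.exp (Real.exp 1 * (n * y) - a) := by
  calc ∑ S : Finset (Fin n) with a ≤ #S, y ^ #S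
      ≤ ∑ S : Finset (Fin n) with a ≤ #S, Real.exp (-a) * (Real.exp 1 * y) ^ #S := by
        refine sum_le_sum fun S hS => ?_
        rw [mul_pow, ← Real.exp_nat_mul, ← mul_assoc, ← Real.exp_add]
        refine le_mul_of_one_le_left (by positivity) (Real.one_le_exp ?_)
        simp only [mem_filter, mem_univ, true_and] at hS
        linarith
    _ ≤ ∑ S : Finset (Fin n), Real.exp (-a) * (Real.exp 1 * y) ^ #S :=
        sum_le_sum_of_subset_of_nonneg (subset_univ _) fun _ _ _ => by positivity
    _ ≤ _ := by
        rw [← mul_sum, sub_eq_neg_add, Real.exp_add]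
        refine mul_le_mul_of_nonneg_left ?_ (by positivity)
        have := Fintype.sum_pow_mul_eq_add_pow (Fin n) (Real.exp 1 * y) 1
        simp only [one_pow, mul_one, Fintype.card_fin] at this
        rw [this, mul_left_comm, Real.exp_nat_mul]
        exact pow_le_pow_left₀ (by positivity) (Real.add_one_le_exp _) n

end SubsetSums

section CrossingWeights

variable {k n : ℕ} {H : SimpleGraph (Fin k)}

theorem exp_neg_crossing_le (hn : 2 ≤ n) (hk : 0 < k)
    (hiso : ∀ v, (H.neighborSet v).Nonempty) (hkn : k ≤ n) {m : ℕ} {a : ℝ}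
    (ha : (k * m / n : ℝ) * (a ^ 2 * k / (n - 1)) ≤ 1) (S : Finset (Fin n))
    (hS : 2 * #S ≤ n) (hS0 : S.Nonempty) :
    Real.exp (-(#(crossing H S) * m / numCopies H n)) ≤
      (if (#S : ℝ) ≤ a then Real.exp 1 * Real.exp (-(k * m / n)) ^ #S else 0) +
      (if a ≤ #S then Real.exp (-(7 / 8 * (k * m / n))) ^ #S else 0) +
      (if (n / (8 * k) : ℝ) ≤ #S then Real.exp (-(1 / (2 * k ^ 3) * (k * m / n))) ^ #S
        else 0) := by
  have hN : (Fintype.card (Copy H n) : ℝ) = numCopies H n := by exact_mod_cast card_copy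
  have hNpos : (0 : ℝ) < numCopies H n := by
    rw [← hN]
    exact_mod_cast Fintype.card_pos_iff.2 (nonempty_copy hkn)
  have hsmall := crossing_lower_of_small hn hk hiso S
  have hlarge := crossing_lower_of_large hn hk hiso S hS
  rw [hN] at hsmall hlarge
  have hn2 : (2 : ℝ) ≤ n := by exact_mod_cast hn
  have hk1 : (1 : ℝ) ≤ k := by exact_mod_cast hk
  have hs1 : (1 : ℝ) ≤ #S := by exact_mod_cast hS0.card_pos
  have hsn : (#S : ℝ) ≤ n := by exact_mod_cast (show #S ≤ n by omega)
  have key : ∀ r : ℝ, numCopies H n * r ≤ #(crossing H S) →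
      r * m ≤ #(crossing H S) * m / numCopies H n := fun r hr => by
    rw [le_div_iff₀ hNpos]
    nlinarith [Nat.cast_nonneg (α := ℝ) m]
  have hA := key (#S * k / n * (1 - (#S - 1) * (k - 1) / (n - 1))) (by rwa [← mul_assoc])
  have hC := key _ hlarge
  have hlam : (0 : ℝ) ≤ k * m / n := by positivity
  have h0 : ∀ (p : Prop) (z : ℝ), 0 ≤ z → 0 ≤ if p then z else 0 := fun p z hz => by
    split_ifs <;> simp [hz]
  have e1 := h0 ((#S : ℝ) ≤ a) (Real.exp 1 * Real.exp (-(k * m / n)) ^ #S) (by positivity)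
  have e2 := h0 (a ≤ #S) (Real.exp (-(7 / 8 * (k * m / n : ℝ))) ^ #S) (by positivity)
  have e3 := h0 ((n / (8 * k) : ℝ) ≤ #S)
    (Real.exp (-(1 / (2 * k ^ 3) * (k * m / n : ℝ))) ^ #S) (by positivity)
  rcases le_total (#S : ℝ) a with hSa | hSa
  · refine le_trans ?_ (add_le_add (add_le_add_right e2 _) e3)
    rw [if_pos hSa, add_zero, add_zero, ← Real.exp_nat_mul, ← Real.exp_add]
    refine Real.exp_le_exp.2 ?_
    have h1 : (#S : ℝ) * ((#S - 1) * (k - 1) / (n - 1)) ≤ a ^ 2 * k / (n - 1) := by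
      rw [mul_div_assoc', div_le_div_iff_of_pos_right (by linarith)]
      have : (#S : ℝ) * (#S - 1) ≤ a ^ 2 := by nlinarith
      have : (0 : ℝ) ≤ #S * (#S - 1) := by nlinarith
      nlinarith
    have h2 := mul_le_mul_of_nonneg_left h1 hlam
    have h3 : (#S * k / n * (1 - (#S - 1) * (k - 1) / (n - 1)) * m : ℝ) =
      #S * (k * m / n) - (k * m / n) * (#S * ((#S - 1) * (k - 1) / (n - 1))) := by ring
    rw [h3] at hA
    linarith
  · rcases le_total (#S : ℝ) (n / (8 * k)) with hSb | hSb
    · refine le_trans ?_ (add_le_add (add_le_add_left e1 _) e3)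
      rw [if_pos hSa, zero_add, add_zero, ← Real.exp_nat_mul]
      refine Real.exp_le_exp.2 ?_
      have h1 : ((#S - 1) * (k - 1) / (n - 1) : ℝ) ≤ 1 / 8 := by
        rw [div_le_iff₀ (by linarith)]
        rw [le_div_iff₀ (by positivity)] at hSb
        nlinarith
      have h2 : (0 : ℝ) ≤ #S * (k * m / n) := by positivity
      have h3 : (#S * k / n * (1 - (#S - 1) * (k - 1) / (n - 1)) * m : ℝ) =
        #S * (k * m / n) * (1 - (#S - 1) * (k - 1) / (n - 1)) := by ring
      rw [h3] at hA
      nlinarith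
    · refine le_trans ?_ (add_le_add_left (add_nonneg e1 e2) _)
      rw [if_pos hSb, zero_add, ← Real.exp_nat_mul]
      refine Real.exp_le_exp.2 ?_
      have h3 : (#S / (2 * k ^ 2 * n) * m : ℝ) = #S * (1 / (2 * k ^ 3) * (k * m / n)) := by
        field_simp
      rw [h3] at hC
      linarith

theorem sum_exp_neg_crossing_le (hn : 2 ≤ n) (hk : 0 < k)
    (hiso : ∀ v, (H.neighborSet v).Nonempty) (hkn : k ≤ n) {m : ℕ} {a : ℝ}
    (ha : (k * m / n : ℝ) * (a ^ 2 * k / (n - 1)) ≤ 1) {u v : Fin n} (huv : u ≠ v) :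
    ∑ S with u ∈ S ∧ v ∈ S ∧ 2 * #S ≤ n,
        Real.exp (-(#(crossing H S) * m / numCopies H n)) ≤
      Real.exp 1 * (Real.exp (-(k * m / n)) ^ 2 * Real.exp (n * Real.exp (-(k * m / n)))) +
      Real.exp (Real.exp 1 * (n * Real.exp (-(7 / 8 * (k * m / n)))) - a) +
      Real.exp (Real.exp 1 * (n * Real.exp (-(1 / (2 * k ^ 3) * (k * m / n)))) -
        n / (8 * k)) := by
  have hsub : ∀ (p : Finset (Fin n) → Prop) (g : Finset (Fin n) → ℝ), (∀ S, 0 ≤ g S) →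
      ∀ T : Finset (Finset (Fin n)), ∑ S ∈ T, (if p S then g S else 0) ≤ ∑ S with p S, g S :=
    fun p g hg T => by
      rw [sum_filter]
      exact sum_le_sum_of_subset_of_nonneg (subset_univ _) fun S _ _ => by
        split_ifs <;> simp [hg]
  refine (sum_le_sum fun S hS => exp_neg_crossing_le hn hk hiso hkn ha S
    (mem_filter.1 hS).2.2.2 ⟨u, (mem_filter.1 hS).2.1⟩).trans ?_
  rw [sum_add_distrib, sum_add_distrib]
  refine add_le_add (add_le_add ?_ ?_) ?_
  · calc _ ≤ ∑ S with u ∈ S ∧ v ∈ S ∧ 2 * #S ≤ n,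
          Real.exp 1 * Real.exp (-(k * m / n : ℝ)) ^ #S :=
          sum_le_sum fun S _ => by
            split_ifs
            · exact le_rfl
            · positivity
      _ ≤ ∑ S with u ∈ S ∧ v ∈ S, Real.exp 1 * Real.exp (-(k * m / n : ℝ)) ^ #S :=
          sum_le_sum_of_subset_of_nonneg
            (fun S hS => by simp only [mem_filter] at hS ⊢; tauto) fun _ _ _ => by positivity
      _ ≤ _ := by
          rw [← mul_sum]
          exact mul_le_mul_of_nonneg_left (sum_pow_card_filter_pair_le huv (by positivity))
            (by positivity)
  · exact (hsub _ _ (fun S => by positivity) _).trans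
      (sum_pow_card_filter_large_le (by positivity) _)
  · exact (hsub _ _ (fun S => by positivity) _).trans
      (sum_pow_card_filter_large_le (by positivity) _)

end CrossingWeights

section Asymptotics

/-- An upper bound for `P(τ_c ≠ τ_1)` on `n` vertices, as a function of `L = log n`. -/
noncomputable def errorBound (k : ℕ) (L : ℝ) : ℝ :=
  1 / (1 + L * Real.exp (-3)) + Real.exp (-L) +
    k ^ 2 * Real.exp 2 * (Real.exp 1 * (L ^ 3 * Real.exp (-(1 / 2 * L))) +
      3 * (L * Real.exp L * Real.exp (3 * Real.exp (1 / 4 * L) - 1 * Real.exp (2 / 5 * L))) +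
      3 * (L * Real.exp L * Real.exp (3 * Real.exp ((1 - 1 / (4 * k ^ 3)) * L) -
        1 / (8 * k) * Real.exp (1 * L))))

theorem tendsto_mul_exp_mul_exp_sub {α β γ : ℝ} (hαγ : α < γ) (hβ : 0 < β) (hγ : 0 < γ) :
    Tendsto (fun L : ℝ => L * Real.exp L * Real.exp (3 * Real.exp (α * L) - β * Real.exp (γ * L)))
      atTop (nhds 0) := by
  have h1 : (fun L : ℝ => Real.exp (α * L)) =o[atTop] fun L => Real.exp (γ * L) := by
    rw [Real.isLittleO_exp_comp_exp_comp]
    simp only [← sub_mul]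
    exact tendsto_id.const_mul_atTop (sub_pos.2 hαγ)
  have h2 : (fun L : ℝ => L) =o[atTop] fun L => Real.exp (γ * L) := by
    simpa using isLittleO_pow_exp_pos_mul_atTop 1 hγ
  have h3 := ((h1.const_mul_left 3).add (h2.const_mul_left 2)).def hβ
  have h4 : Tendsto (fun L : ℝ => L * Real.exp (-L)) atTop (nhds 0) := by
    simpa using Real.tendsto_pow_mul_exp_neg_atTop_nhds_zero 1
  refine squeeze_zero' ?_ ?_ h4
  · filter_upwards [eventually_ge_atTop 0] with L hL
    positivity
  · filter_upwards [h3, eventually_ge_atTop 0] with L h hL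
    rw [mul_assoc, ← Real.exp_add]
    refine mul_le_mul_of_nonneg_left (Real.exp_le_exp.2 ?_) hL
    rw [Real.norm_eq_abs, Real.norm_eq_abs, abs_of_pos (Real.exp_pos _)] at h
    linarith [le_abs_self (3 * Real.exp (α * L) + 2 * L)]

theorem tendsto_errorBound {k : ℕ} (hk : 0 < k) : Tendsto (errorBound k) atTop (nhds 0) := by
  have hk0 : (0 : ℝ) < k := by exact_mod_cast hk
  have h1 : Tendsto (fun L : ℝ => 1 / (1 + L * Real.exp (-3))) atTop (nhds 0) := by
    simp only [one_div]
    exact (tendsto_atTop_add_const_left _ 1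
      (tendsto_id.atTop_mul_const (Real.exp_pos _))).inv_tendsto_atTop
  have h2 : Tendsto (fun L : ℝ => Real.exp (-L)) atTop (nhds 0) :=
    Real.tendsto_exp_neg_atTop_nhds_zero
  have h3 : Tendsto (fun L : ℝ => L ^ 3 * Real.exp (-(1 / 2 * L))) atTop (nhds 0) := by
    have := (isLittleO_pow_exp_pos_mul_atTop 3
      (by norm_num : (0 : ℝ) < 1 / 2)).tendsto_div_nhds_zero
    simpa only [Real.exp_neg, div_eq_mul_inv] using this
  have h4 := tendsto_mul_exp_mul_exp_sub (α := 1 / 4) (β := 1) (γ := 2 / 5)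
    (by norm_num) (by norm_num) (by norm_num)
  have h5 := tendsto_mul_exp_mul_exp_sub (α := 1 - 1 / (4 * k ^ 3)) (β := 1 / (8 * k)) (γ := 1)
    (by rw [sub_lt_self_iff]; positivity) (by positivity) (by norm_num)
  have := (h1.add h2).add ((((h3.const_mul (Real.exp 1)).add (h4.const_mul 3)).add
    (h5.const_mul 3)).const_mul (k ^ 2 * Real.exp 2))
  simp only [mul_zero, add_zero] at this
  exact this

theorem le_errorBound {k : ℕ} (hk : 0 < k) {n L l M μ : ℝ} (hL : Real.exp L = n) (hL2 : 2 ≤ L)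
    (hl1 : L - Real.log L + 1 ≤ l) (hl2 : 9 / 10 * L ≤ l) (hM1 : 2 * n * L ≤ M)
    (hM2 : M ≤ 3 * n * L) (hμ : μ ≤ L - Real.log L + 3) :
    1 / (1 + n * Real.exp (-μ)) + n * Real.exp (-(k * M / n)) +
      k ^ 2 * M * Real.exp 2 *
        (Real.exp 1 * (Real.exp (-l) ^ 2 * Real.exp (n * Real.exp (-l))) +
        Real.exp (Real.exp 1 * (n * Real.exp (-(7 / 8 * l))) - Real.exp (2 / 5 * L)) +
        Real.exp (Real.exp 1 * (n * Real.exp (-(1 / (2 * k ^ 3) * l))) - n / (8 * k))) ≤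
      errorBound k L := by
  have hk1 : (1 : ℝ) ≤ k := by exact_mod_cast hk
  have hn0 : 0 < n := hL ▸ Real.exp_pos L
  have hM0 : 0 ≤ M := le_trans (by positivity) hM1
  have hnexp : ∀ y, n * Real.exp y = Real.exp (L + y) := fun y => by rw [← hL, Real.exp_add]
  have hLexp : ∀ y, L * Real.exp y = Real.exp (Real.log L + y) := fun y => by
    rw [Real.exp_add, Real.exp_log (by linarith)]
  have hnx : n * Real.exp (-l) ≤ L / 2 := by
    calc n * Real.exp (-l) ≤ L * Real.exp (-1) := by
          rw [hnexp, hLexp]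
          exact Real.exp_le_exp.2 (by linarith)
      _ ≤ L / 2 := by
          rw [Real.exp_neg, div_eq_mul_inv]
          gcongr
          linarith [Real.add_one_le_exp (1 : ℝ)]
  have hE1 : L * Real.exp (-3) ≤ n * Real.exp (-μ) := by
    rw [hnexp, hLexp]
    exact Real.exp_le_exp.2 (by linarith)
  have hE2 : n * Real.exp (-(k * M / n)) ≤ Real.exp (-L) := by
    have : 2 * L ≤ k * M / n := by
      rw [le_div_iff₀ hn0]
      nlinarith
    rw [hnexp]
    exact Real.exp_le_exp.2 (by linarith)
  have hB : ∀ {c d : ℝ}, 0 ≤ c → d ≤ c * (9 / 10) →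
      Real.exp 1 * (n * Real.exp (-(c * l))) ≤ 3 * Real.exp ((1 - d) * L) :=
    fun {c d} hc hd => by
      refine mul_le_mul Real.exp_one_lt_three.le ?_ (by positivity) (by norm_num)
      rw [hnexp]
      refine Real.exp_le_exp.2 ?_
      have := mul_le_mul_of_nonneg_left hl2 hc
      nlinarith
  have hWA : M * (Real.exp 1 * (Real.exp (-l) ^ 2 * Real.exp (n * Real.exp (-l)))) ≤
      Real.exp 1 * (L ^ 3 * Real.exp (-(1 / 2 * L))) := by
    have h1 : Real.exp (-l) ≤ L / 2 / n := by
      rw [le_div_iff₀ hn0]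
      linarith
    calc _ ≤ 3 * n * L * (Real.exp 1 * ((L / 2 / n) ^ 2 * Real.exp (L / 2))) := by gcongr
      _ = Real.exp 1 * (3 / 4 * L ^ 3 * (Real.exp (L / 2) / n)) := by
        field_simp
        ring
      _ ≤ Real.exp 1 * (L ^ 3 * Real.exp (-(1 / 2 * L))) := by
        rw [← hL, ← Real.exp_sub, show L / 2 - L = -(1 / 2 * L) by ring]
        gcongr
        have : 0 ≤ L ^ 3 := by positivity
        linarith
  have hWB : M * Real.exp (Real.exp 1 * (n * Real.exp (-(7 / 8 * l))) - Real.exp (2 / 5 * L)) ≤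
      3 * (L * Real.exp L *
        Real.exp (3 * Real.exp (1 / 4 * L) - 1 * Real.exp (2 / 5 * L))) := by
    have h1 := hB (c := 7 / 8) (d := 3 / 4) (by norm_num) (by norm_num)
    rw [show (1 - 3 / 4 : ℝ) = 1 / 4 by norm_num] at h1
    calc _ ≤ 3 * n * L * Real.exp (3 * Real.exp (1 / 4 * L) - Real.exp (2 / 5 * L)) :=
          mul_le_mul hM2 (Real.exp_le_exp.2 (sub_le_sub_right h1 _)) (by positivity)
            (by positivity)
      _ = _ := by
        rw [hL, one_mul]
        ring
  have hWC : M * Real.exp (Real.exp 1 * (n * Real.exp (-(1 / (2 * k ^ 3) * l))) - n / (8 * k)) ≤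
      3 * (L * Real.exp L *
        Real.exp (3 * Real.exp ((1 - 1 / (4 * k ^ 3)) * L) - 1 / (8 * k) * Real.exp (1 * L))) := by
    have h1 := hB (c := 1 / (2 * k ^ 3)) (d := 1 / (4 * k ^ 3)) (by positivity) (by
      rw [show (1 / (4 * k ^ 3) : ℝ) = 1 / (2 * k ^ 3) * (1 / 2) by field_simp; norm_num]
      exact mul_le_mul_of_nonneg_left (by norm_num) (by positivity))
    calc _ ≤ 3 * n * L * Real.exp (3 * Real.exp ((1 - 1 / (4 * k ^ 3)) * L) - n / (8 * k)) :=
          mul_le_mul hM2 (Real.exp_le_exp.2 (sub_le_sub_right h1 _)) (by positivity)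
            (by positivity)
      _ = _ := by
        rw [one_mul, hL, div_mul_eq_mul_div, one_mul]
        ring
  unfold errorBound
  refine add_le_add (add_le_add ?_ hE2) ?_
  · have : 0 < L * Real.exp (-3) := by positivity
    exact one_div_le_one_div_of_le (by linarith) (by linarith)
  · have := mul_le_mul_of_nonneg_left (add_le_add (add_le_add hWA hWB) hWC)
      (show (0 : ℝ) ≤ k ^ 2 * Real.exp 2 by positivity)
    refine le_trans (le_of_eq ?_) this
    ring

theorem exists_ratio {k n m N L : ℝ} (hk : 1 ≤ k) (hn : 0 < n) (hm : 0 ≤ m) (hN : 0 < N)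
    (hL : 2 ≤ L) (hn64 : 32 * k ^ 2 * L ^ 2 ≤ n) (hl : k * m / n ≤ 2 * L)
    (hmN : m / N ≤ 4 * k ^ 2 * L / n) :
    ∃ q : ℝ, 0 ≤ q ∧ q ≤ 1 / 2 ∧ k * N / n ≤ q * (N - m) ∧
      m * (q + 2 * q ^ 2) ≤ k * m / n + 1 := by
  have hkk : 0 ≤ k ^ 2 - k := by nlinarith
  have hkL : 64 * (k ^ 2 * L) ≤ n := by
    have : 0 ≤ k ^ 2 * L * (L - 2) := mul_nonneg (by positivity) (by linarith)
    linarith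
  have hkL' : 64 * (k * L) ≤ n := by nlinarith
  have hmN0 : 0 ≤ m / N := by positivity
  have hmN1 : m / N ≤ 1 / 16 := by
    refine hmN.trans ?_
    rw [div_le_iff₀ hn]
    linarith
  have hkn : k / n ≤ 1 / 128 := by
    rw [div_le_iff₀ hn]
    nlinarith
  have hkn0 : 0 ≤ k / n := by positivity
  have hq2 : k / n * (1 + 2 * (m / N)) ≤ 2 * (k / n) := by nlinarith
  refine ⟨k / n * (1 + 2 * (m / N)), by positivity, by linarith, ?_, ?_⟩
  · have h2 : k / n * (1 + 2 * (m / N)) * (N - m) =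
        k / n * N * ((1 + 2 * (m / N)) * (1 - m / N)) := by
      field_simp
    rw [h2, mul_div_right_comm]
    refine le_mul_of_one_le_right (by positivity) ?_
    nlinarith
  · have h1 : m * (k / n * (1 + 2 * (m / N))) = k * m / n + k * m / n * (2 * (m / N)) := by
      ring
    have h2 : k * m / n * (2 * (m / N)) ≤ 1 / 2 := by
      calc k * m / n * (2 * (m / N)) ≤ 2 * L * (2 * (4 * k ^ 2 * L / n)) := by gcongr
        _ = 16 * k ^ 2 * L ^ 2 / n := by ring
        _ ≤ 1 / 2 := by
          rw [div_le_iff₀ hn]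
          linarith
    have h3 : m * (2 * (k / n * (1 + 2 * (m / N))) ^ 2) ≤ 1 / 2 := by
      calc m * (2 * (k / n * (1 + 2 * (m / N))) ^ 2) ≤ m * (2 * (2 * (k / n)) ^ 2) := by gcongr
        _ = k * m / n * (8 * k / n) := by ring
        _ ≤ 2 * L * (8 * k / n) := by gcongr
        _ = 16 * k * L / n := by ring
        _ ≤ 1 / 2 := by
          rw [div_le_iff₀ hn]
          linarith
    rw [mul_add, h1]
    linarith

variable {k n : ℕ} {H : SimpleGraph (Fin k)}

theorem one_sub_errorBound_le (hk : 0 < k) (hiso : ∀ v, (H.neighborSet v).Nonempty) {L : ℝ}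
    (hL : Real.exp L = n) (hL2 : 2 ≤ L) (hLlog : Real.log L ≤ L / 10)
    (hLsq : 32 * k ^ 2 * L ^ 2 ≤ Real.exp L) (hLk : 4 * k * L ≤ Real.exp (L / 5)) :
    1 - errorBound k L ≤ procProb H n (fun ω => tauConn ω = tauDeg 1 ω) := by
  have hk1 : (1 : ℝ) ≤ k := by exact_mod_cast hk
  have hksq : (k : ℝ) ≤ k ^ 2 := by nlinarith
  have hn64 : 32 * k ^ 2 * L ^ 2 ≤ (n : ℝ) := hL ▸ hLsq
  have hkL : 64 * (k ^ 2 * L) ≤ (n : ℝ) := by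
    have : (0 : ℝ) ≤ k ^ 2 * L := by positivity
    nlinarith
  have hk128 : 128 * (k : ℝ) ^ 2 ≤ n := by nlinarith
  have hkn' : 128 * (k : ℝ) ≤ n := by nlinarith
  have hn2' : (2 : ℝ) ≤ n := by linarith
  have hn : 2 ≤ n := by exact_mod_cast hn2'
  have hkn : k ≤ n := by
    have : (k : ℝ) ≤ n := by linarith
    exact_mod_cast this
  have hn0 : (0 : ℝ) < n := by linarith
  have hN : (n : ℝ) ^ 2 / (2 * k ^ 2) ≤ numCopies H n := by
    have h := (Nat.cast_le (α := ℝ)).2 (mul_le_card_copy hk hiso hkn)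
    push_cast [Nat.cast_sub (show 1 ≤ n by omega), card_copy] at h
    rw [div_le_iff₀ (by positivity)]
    nlinarith
  have hNn : 32 * n * L ≤ (numCopies H n : ℝ) := by
    refine le_trans ?_ hN
    rw [le_div_iff₀ (by positivity)]
    nlinarith
  set N : ℝ := (numCopies H n : ℝ) with hNdef
  have hlog : 0 ≤ Real.log L := Real.log_nonneg (by linarith)
  set m : ℕ := ⌊n * (L - Real.log L + 2) / k⌋₊ with hm
  set M : ℕ := ⌈2 * n * L⌉₊ with hM
  have hx0 : (0 : ℝ) ≤ n * (L - Real.log L + 2) / k :=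
    div_nonneg (mul_nonneg hn0.le (by linarith)) (by linarith)
  have hm1 : (m : ℝ) ≤ n * (L - Real.log L + 2) / k := Nat.floor_le hx0
  have hm2 : n * (L - Real.log L + 2) / k < m + 1 := Nat.lt_floor_add_one _
  have hM1 : 2 * n * L ≤ (M : ℝ) := Nat.le_ceil _
  have hM2 : (M : ℝ) ≤ 3 * n * L := by
    have := (Nat.ceil_lt_add_one (a := 2 * n * L) (by positivity)).le
    nlinarith
  have hlam1 : (k * m / n : ℝ) ≤ L - Real.log L + 2 := by
    rw [le_div_iff₀ (by linarith)] at hm1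
    rw [div_le_iff₀ hn0]
    linarith
  have hlam2 : L - Real.log L + 1 ≤ (k * m / n : ℝ) := by
    rw [div_lt_iff₀ (by linarith)] at hm2
    rw [le_div_iff₀ hn0]
    nlinarith
  have hlam3 : (k * m / n : ℝ) ≤ 2 * L := by linarith
  have hlam4 : 9 / 10 * L ≤ (k * m / n : ℝ) := by linarith
  have hlam0 : (0 : ℝ) ≤ k * m / n := by positivity
  have hmn : (m : ℝ) ≤ 2 * n * L := by
    rw [div_le_iff₀ hn0] at hlam3
    nlinarith [Nat.cast_nonneg (α := ℝ) m]
  have hNpos : 0 < N := by nlinarith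
  have hmN : (m : ℝ) ≤ N / 16 := by linarith
  have hmN' : m ≤ numCopies H n := by
    have : (m : ℝ) ≤ numCopies H n := by linarith
    exact_mod_cast this
  have hMN' : M ≤ numCopies H n := by
    have : (M : ℝ) ≤ numCopies H n := by nlinarith
    exact_mod_cast this
  have hmNr : (m : ℝ) / N ≤ 4 * k ^ 2 * L / n := by
    rw [div_le_div_iff₀ hNpos hn0]
    rw [div_le_iff₀ (by positivity)] at hN
    calc (m : ℝ) * n ≤ 2 * n * L * n := by gcongr
      _ = 2 * L * n ^ 2 := by ring
      _ ≤ 2 * L * (N * (2 * k ^ 2)) := by gcongr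
      _ = _ := by ring
  have ha : (k * m / n : ℝ) * (Real.exp (2 / 5 * L) ^ 2 * k / (n - 1)) ≤ 1 := by
    have h1 : Real.exp (2 / 5 * L) ^ 2 * Real.exp (L / 5) = n := by
      rw [← Real.exp_nat_mul, ← Real.exp_add, ← hL]
      congr 1
      push_cast
      ring
    rw [mul_div_assoc', div_le_one (by linarith)]
    calc (k * m / n : ℝ) * (Real.exp (2 / 5 * L) ^ 2 * k)
        ≤ 2 * L * (Real.exp (2 / 5 * L) ^ 2 * k) := by gcongr
      _ = Real.exp (2 / 5 * L) ^ 2 * (4 * k * L) / 2 := by ring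
      _ ≤ Real.exp (2 / 5 * L) ^ 2 * Real.exp (L / 5) / 2 := by gcongr
      _ ≤ n - 1 := by
        rw [h1]
        linarith
  obtain ⟨q, hq0, hq, hqN, hqm⟩ := exists_ratio hk1 hn0 (Nat.cast_nonneg m) hNpos hL2 hn64
    hlam3 hmNr
  refine le_trans (sub_le_sub_left ?_ 1) (one_sub_le_procProb_tauConn_eq hn hk hiso hkn hmN' hMN'
    hq0 hq hqN fun u v huv => sum_exp_neg_crossing_le hn hk hiso hkn ha huv)
  exact le_errorBound hk hL hL2 hlam2 hlam4 hM1 hM2 (by linarith)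

theorem tendsto_procProb_tauConn_eq (hk : 0 < k) (hiso : ∀ v, (H.neighborSet v).Nonempty) :
    Tendsto (fun n => procProb H n (fun ω => tauConn ω = tauDeg 1 ω)) atTop (nhds 1) := by
  have hlog : Tendsto (fun n : ℕ => Real.log n) atTop atTop :=
    Real.tendsto_log_atTop.comp tendsto_natCast_atTop_atTop
  have hlower : Tendsto (fun n : ℕ => 1 - errorBound k (Real.log n)) atTop (nhds 1) := by
    simpa using ((tendsto_errorBound hk).comp hlog).const_sub 1
  have hev : ∀ᶠ L : ℝ in atTop, 2 ≤ L ∧ Real.log L ≤ L / 10 ∧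
      32 * k ^ 2 * L ^ 2 ≤ Real.exp L ∧ 4 * k * L ≤ Real.exp (L / 5) := by
    have h1 := Real.isLittleO_log_id_atTop.def (show (0 : ℝ) < 1 / 10 by norm_num)
    have h2 := ((isLittleO_pow_exp_pos_mul_atTop 2 one_pos).const_mul_left
      (32 * k ^ 2 : ℝ)).def one_pos
    have h3 := ((isLittleO_pow_exp_pos_mul_atTop 1 (by norm_num : (0 : ℝ) < 1 / 5)).const_mul_left
      (4 * k : ℝ)).def one_pos
    filter_upwards [h1, h2, h3, eventually_ge_atTop 2] with L h1 h2 h3 hL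
    simp only [Real.norm_eq_abs, Real.abs_exp, one_mul, id, pow_one] at h1 h2 h3
    rw [abs_of_nonneg (show 0 ≤ L by linarith)] at h1
    refine ⟨hL, by linarith [le_abs_self (Real.log L)], (le_abs_self _).trans h2, ?_⟩
    rw [show L / 5 = 1 / 5 * L by ring]
    exact (le_abs_self _).trans h3
  refine tendsto_of_tendsto_of_tendsto_of_le_of_le' hlower tendsto_const_nhds ?_ ?_
  · filter_upwards [hlog.eventually hev, eventually_gt_atTop 0] with n h hn
    exact one_sub_errorBound_le hk hiso (Real.exp_log (by exact_mod_cast hn)) h.1 h.2.1 h.2.2.1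
      h.2.2.2
  · filter_upwards with n
    have : Nonempty (ProcSample H n) := ⟨(Fintype.equivFinOfCardEq card_copy).symm⟩
    rw [procProb_eq_unifProb]
    linarith [unifProb_add_unifProb_not (fun ω : ProcSample H n => tauConn ω = tauDeg 1 ω),
      unifProb_nonneg (fun ω : ProcSample H n => ¬ tauConn ω = tauDeg 1 ω)]

end Asymptotics

end Proofs

/-- **Theorem 3 (hitting time of connectivity).**  W.h.p. the random motif graph
process becomes connected exactly when the minimum degree becomes `1`:
`τ_c = τ_1`. -/
theorem hitting_time_connectivity {k : ℕ} (H : SimpleGraph (Fin k)) (hk : 0 < k)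
    (hiso : ∀ v, (H.neighborSet v).Nonempty) :
    Tendsto (fun n => procProb H n (fun ω => tauConn ω = tauDeg 1 ω))
      atTop (nhds 1) := by
  exact tendsto_procProb_tauConn_eq hk hiso

end RandomMotif
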